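/- Let (W,S) be a finite Coxeter system, c a Coxeter element, w a c-singleton, and 𝐰 its c-sorting word. Then every element of W that is a prefix of 𝐰 up to commutations is again a c-singleton. -/

import Mathlib

noncomputable section

namespace CambrianPaper

open CoxeterSystem

variable {B : Type*} {W : Type*} [Group W] {M : CoxeterMatrix B}

/-- One greedy pass of the letters of `c` over `u`: returns the taken letters (in order) and
the new remainder.  A letter `q` is taken if it is a left descent of the current remainder. -/
def pass (cs : CoxeterSystem M W) (c : List B) (u : W) : List B × W :=
  c.foldl (fun p q =>
    if cs.length (cs.simple q * p.2) < cs.length p.2 then (p.1 ++ [q], cs.simple q * p.2)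
    else p) ([], u)

/-- The remainder of `w` after `n` greedy passes of `c`. -/
def remainder (cs : CoxeterSystem M W) (c : List B) (w : W) : ℕ → W
  | 0 => w
  | n + 1 => (pass cs c (remainder cs c w n)).2

/-- The `n`-th factor (`n = 0, 1, 2, …`) of the `c`-factorization of `w`:
the letters of `c` taken in the `n`-th greedy pass.  (All but finitely many factors are
empty; the nonempty ones are the `c_{(K_i)}` of the `c`-factorization of `w`.) -/
def factor (cs : CoxeterSystem M W) (c : List B) (w : W) (n : ℕ) : List B :=
  (pass cs c (remainder cs c w n)).1

/-- The `c`-sorting word of `w` : the concatenation of the factors of the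
`c`-factorization of `w` (the lexicographically first reduced subword of `c^∞` for `w`);
`cs.length w` passes always suffice. -/
def sortingWord (cs : CoxeterSystem M W) (c : List B) (w : W) : List B :=
  ((List.range (cs.length w)).map (factor cs c w)).flatten

/-- `w` is `c`-sortable : the factors of its `c`-factorization are nested. -/
def IsSortable (cs : CoxeterSystem M W) (c : List B) (w : W) : Prop :=
  ∀ n : ℕ, ∀ q ∈ factor cs c w (n + 1), q ∈ factor cs c w n

/-- `w` is a `c`-singleton : `w` is `c`-sortable and `w w₀` is `c⁻¹`-sortable
(the reduced word `c.reverse` represents the inverse of the Coxeter element). -/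
def IsCSingleton (cs : CoxeterSystem M W) (c : List B) (w₀ w : W) : Prop :=
  IsSortable cs c w ∧ IsSortable cs c.reverse (w * w₀)

/-- The right weak order on `W`. -/
def weakLE (cs : CoxeterSystem M W) (u v : W) : Prop :=
  cs.length v = cs.length u + cs.length (u⁻¹ * v)

/-- A single commutation move on words: interchange two adjacent commuting letters. -/
def CommMove (M : CoxeterMatrix B) (l l' : List B) : Prop :=
  ∃ l₁ l₂ : List B, ∃ a b : B, M a b = 2 ∧ l = l₁ ++ a :: b :: l₂ ∧ l' = l₁ ++ b :: a :: l₂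

/-- Equivalence of words up to commutations. -/
def CommEquiv (M : CoxeterMatrix B) : List B → List B → Prop :=
  Relation.ReflTransGen (CommMove M)

/-- `u ∈ W` is a prefix of the word `v` up to commutations. -/
def IsPrefixUpToComm (cs : CoxeterSystem M W) (v : List B) (u : W) : Prop :=
  ∃ v' u' : List B, CommEquiv M v v' ∧ u' <+: v' ∧ cs.wordProd u' = u

section Geometry

set_option linter.unusedSectionVars false

variable [Fintype B] [DecidableEq B]

/-- The Gram matrix of the geometric representation. -/
def gram (M : CoxeterMatrix B) : Matrix B B ℝ := fun i j => -Real.cos (Real.pi / M i j)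

/-- The invariant symmetric bilinear form of the geometric representation. -/
def form (M : CoxeterMatrix B) : LinearMap.BilinForm ℝ (B → ℝ) := Matrix.toBilin' (gram M)

/-- The simple roots: the standard basis of the geometric representation. -/
def simpleRoot (i : B) : B → ℝ := Pi.single i 1

/-- The reflection in a simple root. -/
def simpleRefl (M : CoxeterMatrix B) (i : B) : Module.End ℝ (B → ℝ) :=
  LinearMap.id - (2 : ℝ) • (form M (simpleRoot i)).smulRight (simpleRoot i)

lemma simpleRefl_apply (i : B) (x : B → ℝ) :
    simpleRefl M i x = x - (2 * form M (simpleRoot i) x) • simpleRoot i := by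
  simp [simpleRefl, mul_smul]

lemma gram_symm (i j : B) : gram M i j = gram M j i := by
  simp [gram, M.symmetric i j]

lemma gram_self (i : B) : gram M i i = 1 := by
  simp [gram]

lemma form_simpleRoot (i j : B) : form M (simpleRoot i) (simpleRoot j) = gram M i j := by
  simp [form, simpleRoot]

lemma form_comm (x y : B → ℝ) : form M x y = form M y x := by
  simp only [form, Matrix.toBilin'_apply]
  rw [Finset.sum_comm]
  refine Finset.sum_congr rfl fun i _ => Finset.sum_congr rfl fun j _ => ?_
  rw [gram_symm]
  ring

lemma gram_nonpos {i j : B} (h : i ≠ j) : gram M i j ≤ 0 := by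
  have h1 : M i j ≠ 1 := M.off_diagonal i j h
  simp only [gram, neg_nonpos]
  rcases Nat.eq_zero_or_pos (M i j) with h0 | h0
  · simp [h0]
  · have h2 : (2 : ℝ) ≤ M i j := by exact_mod_cast (by omega : 2 ≤ M i j)
    apply Real.cos_nonneg_of_neg_pi_div_two_le_of_le
    · have : 0 ≤ Real.pi / M i j := by positivity
      linarith [Real.pi_pos]
    · exact div_le_div_of_nonneg_left Real.pi_pos.le two_pos h2

lemma gram_eq_zero_iff {i j : B} : gram M i j = 0 ↔ M i j = 2 := by
  constructor
  · intro h
    have hij : i ≠ j := by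
      rintro rfl
      simp [gram_self] at h
    have h1 : M i j ≠ 1 := M.off_diagonal i j hij
    simp only [gram, neg_eq_zero] at h
    by_contra h2
    rcases Nat.eq_zero_or_pos (M i j) with h0 | h0
    · simp [h0] at h
    · have h3 : (2 : ℝ) < M i j := by exact_mod_cast (by omega : 2 < M i j)
      have : 0 < Real.cos (Real.pi / M i j) := by
        apply Real.cos_pos_of_mem_Ioo
        constructor
        · have : 0 ≤ Real.pi / M i j := by positivity
          linarith [Real.pi_pos]
        · exact div_lt_div_of_pos_left Real.pi_pos two_pos h3
      linarith
  · intro h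
    simp [gram, h]

lemma simpleRefl_simpleRoot (i j : B) :
    simpleRefl M i (simpleRoot j) = simpleRoot j - (2 * gram M i j) • simpleRoot i := by
  rw [simpleRefl_apply, form_simpleRoot]

lemma simpleRefl_self (i : B) : simpleRefl M i (simpleRoot i) = -simpleRoot i := by
  rw [simpleRefl_simpleRoot, gram_self]
  module

lemma form_simpleRefl (i : B) (x y : B → ℝ) :
    form M (simpleRefl M i x) (simpleRefl M i y) = form M x y := by
  simp only [simpleRefl_apply, map_sub, map_smul, LinearMap.sub_apply, LinearMap.smul_apply,
    smul_eq_mul, form_simpleRoot, gram_self, form_comm _ (simpleRoot i)]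
  ring

lemma simpleRefl_mul_self (i : B) : simpleRefl M i * simpleRefl M i = 1 := by
  refine LinearMap.ext fun x => ?_
  simp only [Module.End.mul_apply, simpleRefl_apply, map_sub, map_smul,
    form_simpleRoot, gram_self, Module.End.one_apply]
  module

/-- The values `sin (k θ) / sin θ` for `x = 2 cos θ`. -/
def chebSeq (x : ℝ) : ℕ → ℝ
  | 0 => 0
  | 1 => 1
  | k + 2 => x * chebSeq x (k + 1) - chebSeq x k

lemma sin_mul_chebSeq (θ : ℝ) (k : ℕ) :
    Real.sin θ * chebSeq (2 * Real.cos θ) k = Real.sin (k * θ) := by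
  induction k using Nat.twoStepInduction with
  | zero => simp [chebSeq]
  | one => simp [chebSeq]
  | more k ih1 ih2 =>
    have h1 : ((k + 2 : ℕ) : ℝ) * θ = ((k + 1 : ℕ) : ℝ) * θ + θ := by push_cast; ring
    have h2 : (k : ℝ) * θ = ((k + 1 : ℕ) : ℝ) * θ - θ := by push_cast; ring
    rw [chebSeq, mul_sub, mul_left_comm, ih1, ih2, h1, h2, Real.sin_add, Real.sin_sub]
    ring

lemma chebSeq_two (k : ℕ) : chebSeq 2 k = k := by
  induction k using Nat.twoStepInduction with
  | zero => simp [chebSeq]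
  | one => simp [chebSeq]
  | more k ih1 ih2 =>
    rw [chebSeq, ih1, ih2]
    push_cast
    ring

lemma sin_pi_div_pos {m : ℕ} (hm : 2 ≤ m) : 0 < Real.sin (Real.pi / m) := by
  have h2 : (2 : ℝ) ≤ m := by exact_mod_cast hm
  apply Real.sin_pos_of_pos_of_lt_pi
  · have := Real.pi_pos
    positivity
  · rw [div_lt_iff₀ (by linarith)]
    nlinarith [Real.pi_pos]

lemma chebSeq_nonneg {i j : B} (hij : i ≠ j) {k : ℕ} (hk : M i j = 0 ∨ k ≤ M i j) :
    0 ≤ chebSeq (-2 * gram M i j) k := by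
  have h1 : M i j ≠ 1 := M.off_diagonal i j hij
  have hx : -2 * gram M i j = 2 * Real.cos (Real.pi / M i j) := by simp [gram]
  rw [hx]
  rcases Nat.eq_zero_or_pos (M i j) with h0 | h0
  · simp [h0, chebSeq_two]
  · have hs := sin_pi_div_pos (m := M i j) (by omega)
    refine nonneg_of_mul_nonneg_right (a := Real.sin (Real.pi / M i j)) ?_ hs
    rw [sin_mul_chebSeq]
    have hk' : (k : ℝ) ≤ M i j := by exact_mod_cast (by omega : k ≤ M i j)
    have hm' : (0 : ℝ) < M i j := by exact_mod_cast h0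
    apply Real.sin_nonneg_of_nonneg_of_le_pi
    · have := Real.pi_pos
      positivity
    · rw [mul_div_assoc', div_le_iff₀ hm']
      nlinarith [Real.pi_pos]

lemma simpleRefl_comb_left (i j : B) (p q : ℝ) :
    simpleRefl M i (p • simpleRoot i + q • simpleRoot j) =
      (-2 * gram M i j * q - p) • simpleRoot i + q • simpleRoot j := by
  rw [map_add, map_smul, map_smul, simpleRefl_self, simpleRefl_simpleRoot]
  module

lemma simpleRefl_comb_right (i j : B) (p q : ℝ) :
    simpleRefl M j (p • simpleRoot i + q • simpleRoot j) =
      p • simpleRoot i + (-2 * gram M i j * p - q) • simpleRoot j := by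
  rw [add_comm, simpleRefl_comb_left, gram_symm, add_comm]

lemma simpleRefl_mul_pow_apply (i j : B) (n : ℕ) :
    ((simpleRefl M i * simpleRefl M j) ^ n) (simpleRoot i) =
      chebSeq (-2 * gram M i j) (2 * n + 1) • simpleRoot i +
        chebSeq (-2 * gram M i j) (2 * n) • simpleRoot j := by
  induction n with
  | zero => simp [chebSeq]
  | succ n ih =>
    rw [pow_succ', Module.End.mul_apply, ih, Module.End.mul_apply, simpleRefl_comb_right,
      simpleRefl_comb_left]
    rfl

lemma simpleRefl_mul_pow_apply_self (i j : B) (hm : 2 ≤ M i j) :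
    ((simpleRefl M i * simpleRefl M j) ^ M i j) (simpleRoot i) = simpleRoot i := by
  have hs := (sin_pi_div_pos hm).ne'
  have hm0 : (M i j : ℝ) ≠ 0 := by
    have : M i j ≠ 0 := by omega
    exact_mod_cast this
  have hx : -2 * gram M i j = 2 * Real.cos (Real.pi / M i j) := by simp [gram]
  have e1 : chebSeq (-2 * gram M i j) (2 * M i j) = 0 := by
    apply mul_left_cancel₀ hs
    rw [hx, sin_mul_chebSeq]
    have : ((2 * M i j : ℕ) : ℝ) * (Real.pi / M i j) = 2 * Real.pi := by
      push_cast
      field_simp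
    rw [this]
    simp
  have e2 : chebSeq (-2 * gram M i j) (2 * M i j + 1) = 1 := by
    apply mul_left_cancel₀ hs
    rw [hx, sin_mul_chebSeq]
    have : ((2 * M i j + 1 : ℕ) : ℝ) * (Real.pi / M i j) = Real.pi / M i j + 2 * Real.pi := by
      push_cast
      field_simp
      ring
    rw [this, Real.sin_add_two_pi, mul_one]
  rw [simpleRefl_mul_pow_apply, e1, e2]
  simp

lemma simpleRefl_liftable : M.IsLiftable (simpleRefl M) := by
  intro i j
  rcases eq_or_ne i j with rfl | hij
  · simp [simpleRefl_mul_self]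
  rcases Nat.eq_zero_or_pos (M i j) with h0 | h0
  · simp [h0]
  have h1 : M i j ≠ 1 := M.off_diagonal i j hij
  have hm : 2 ≤ M i j := by omega
  have hTT' : (simpleRefl M i * simpleRefl M j) * (simpleRefl M j * simpleRefl M i) = 1 := by
    rw [mul_assoc, ← mul_assoc (simpleRefl M j), simpleRefl_mul_self, one_mul,
      simpleRefl_mul_self]
  have hT'T : (simpleRefl M j * simpleRefl M i) * (simpleRefl M i * simpleRefl M j) = 1 := by
    rw [mul_assoc, ← mul_assoc (simpleRefl M i), simpleRefl_mul_self, one_mul,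
      simpleRefl_mul_self]
  have hi := simpleRefl_mul_pow_apply_self i j hm
  have hj : ((simpleRefl M i * simpleRefl M j) ^ M i j) (simpleRoot j) = simpleRoot j := by
    have h := simpleRefl_mul_pow_apply_self j i (by rwa [M.symmetric])
    rw [M.symmetric j i] at h
    conv_lhs => rw [← h]
    rw [← Module.End.mul_apply, ← (show Commute _ _ from hTT'.trans hT'T.symm).mul_pow, hTT',
      one_pow, Module.End.one_apply]
  have hsin := sin_pi_div_pos hm
  have hg : 1 - gram M i j ^ 2 ≠ 0 := by
    have := Real.sin_sq_add_cos_sq (Real.pi / M i j)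
    have e : gram M i j = -Real.cos (Real.pi / M i j) := rfl
    rw [e]
    nlinarith
  have key : ∀ (n : ℕ) (z : B → ℝ), form M (simpleRoot i) z = 0 → form M (simpleRoot j) z = 0 →
      ((simpleRefl M i * simpleRefl M j) ^ n) z = z := by
    intro n z h1 h2
    induction n with
    | zero => simp
    | succ n ih =>
      rw [pow_succ, Module.End.mul_apply, Module.End.mul_apply]
      have e1 : simpleRefl M j z = z := by rw [simpleRefl_apply, h2]; simp
      have e2 : simpleRefl M i z = z := by rw [simpleRefl_apply, h1]; simp
      rw [e1, e2, ih]
  refine LinearMap.ext fun z => ?_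
  obtain ⟨p, q, u, hz, h1, h2⟩ : ∃ (p q : ℝ) (u : B → ℝ),
      z = p • simpleRoot i + q • simpleRoot j + u ∧ form M (simpleRoot i) u = 0 ∧
        form M (simpleRoot j) u = 0 := by
    set g := gram M i j with hgdef
    set a := form M (simpleRoot i) z with ha
    set b := form M (simpleRoot j) z with hb
    refine ⟨(a - g * b) / (1 - g ^ 2), (b - g * a) / (1 - g ^ 2),
      z - ((a - g * b) / (1 - g ^ 2)) • simpleRoot i - ((b - g * a) / (1 - g ^ 2)) • simpleRoot j,
      by module, ?_, ?_⟩
    · simp only [map_sub, map_smul, smul_eq_mul, form_simpleRoot, gram_self, ← ha, ← hgdef]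
      field_simp
      ring
    · simp only [map_sub, map_smul, smul_eq_mul, form_simpleRoot, gram_self, gram_symm j i, ← hb,
        ← hgdef]
      field_simp
      ring
  rw [hz, map_add, map_add, map_smul, map_smul, hi, hj, key _ u h1 h2]
  rfl

/-- The geometric representation. -/
def geom (cs : CoxeterSystem M W) : W →* Module.End ℝ (B → ℝ) :=
  cs.lift ⟨simpleRefl M, simpleRefl_liftable⟩

variable (cs : CoxeterSystem M W)

lemma geom_simple (i : B) : geom cs (cs.simple i) = simpleRefl M i :=
  cs.lift_apply_simple simpleRefl_liftable i

lemma geom_mul_apply (g h : W) (x : B → ℝ) : geom cs (g * h) x = geom cs g (geom cs h x) := by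
  rw [map_mul, Module.End.mul_apply]

lemma geom_inv_apply_self (g : W) (x : B → ℝ) : geom cs g⁻¹ (geom cs g x) = x := by
  rw [← geom_mul_apply, inv_mul_cancel, map_one, Module.End.one_apply]

lemma geom_apply_inv_self (g : W) (x : B → ℝ) : geom cs g (geom cs g⁻¹ x) = x := by
  rw [← geom_mul_apply, mul_inv_cancel, map_one, Module.End.one_apply]

lemma form_geom (g : W) (x y : B → ℝ) : form M (geom cs g x) (geom cs g y) = form M x y := by
  induction g using cs.simple_induction_left with
  | one => simp
  | mul_simple_left w i ih => rw [geom_mul_apply, geom_mul_apply, geom_simple, form_simpleRefl, ih]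

lemma geom_alternatingWord (i j : B) (k : ℕ) :
    geom cs (cs.wordProd (alternatingWord i j k)) (simpleRoot i) =
      if Even k then
        chebSeq (-2 * gram M i j) (k + 1) • simpleRoot i +
          chebSeq (-2 * gram M i j) k • simpleRoot j
      else
        chebSeq (-2 * gram M i j) k • simpleRoot i +
          chebSeq (-2 * gram M i j) (k + 1) • simpleRoot j := by
  induction k with
  | zero => simp [alternatingWord, chebSeq]
  | succ k ih =>
    rw [alternatingWord_succ', cs.wordProd_cons, geom_mul_apply, ih, geom_simple]
    by_cases hk : Even k
    · simp only [hk, if_true, Nat.even_add_one, not_true, if_false]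
      rw [simpleRefl_comb_right]
      rfl
    · simp only [hk, if_false, Nat.even_add_one, not_false_eq_true, if_true]
      rw [simpleRefl_comb_left]
      rfl

lemma simpleRoot_nonneg (i : B) : 0 ≤ (simpleRoot i : B → ℝ) :=
  Pi.single_nonneg.2 zero_le_one

lemma geom_simpleRoot_nonneg (w : W) (i : B) (h : ¬ cs.IsRightDescent w i) :
    0 ≤ geom cs w (simpleRoot i) := by
  induction hn : cs.length w using Nat.strong_induction_on generalizing w i with
  | _ n IH =>
  subst hn
  rcases eq_or_ne w 1 with rfl | hw
  · simpa using simpleRoot_nonneg i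
  obtain ⟨j, hj⟩ := cs.exists_rightDescent_of_ne_one hw
  have hij : i ≠ j := by
    rintro rfl
    exact h hj
  let P : ℕ → Prop := fun k =>
    ∃ v, w = v * cs.wordProd (alternatingWord i j k) ∧ cs.length w = cs.length v + k
  have hlen : ∀ k, cs.length (cs.wordProd (alternatingWord i j k)) ≤ k := fun k =>
    (cs.length_wordProd_le _).trans (by simp)
  have hP1 : P 1 := by
    refine ⟨w * cs.simple j, ?_, ?_⟩
    · simp [alternatingWord]
    · exact (cs.isRightDescent_iff.1 hj).symm
  have hPpred : ∀ k, P (k + 1) → P k := by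
    rintro k ⟨v, hv, hl⟩
    rw [alternatingWord_succ', cs.wordProd_cons, ← mul_assoc] at hv
    refine ⟨_, hv, ?_⟩
    have h1 := cs.length_mul_le (v * cs.simple (if Even k then j else i))
      (cs.wordProd (alternatingWord i j k))
    have h2 := cs.length_mul_le v (cs.simple (if Even k then j else i))
    rw [cs.length_simple] at h2
    rw [← hv] at h1
    have := hlen k
    omega
  have hPle : ∀ k l, k ≤ l → P l → P k := by
    intro k l hkl
    induction hkl with
    | refl => exact id
    | step _ ih => exact fun hp => ih (hPpred _ hp)
  classical
  set k := Nat.findGreatest P (cs.length w) with hk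
  have hw0 : 1 ≤ cs.length w := by
    obtain ⟨v, -, hl⟩ := hP1
    omega
  have hPk : P k := Nat.findGreatest_spec hw0 hP1
  have hk1 : 1 ≤ k := Nat.le_findGreatest hw0 hP1
  have hPk1 : ¬ P (k + 1) := by
    intro hp
    have : k + 1 ≤ k := by
      refine Nat.le_findGreatest ?_ hp
      obtain ⟨v, -, hl⟩ := hp
      omega
    omega
  have hkm : M i j = 0 ∨ k + 1 ≤ M i j := by
    rcases Nat.eq_zero_or_pos (M i j) with h0 | h0
    · exact Or.inl h0
    · right
      by_contra hlt
      obtain ⟨v, hv, hl⟩ := hPle (M i j) k (by omega) hPk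
      apply h
      have e : cs.wordProd (alternatingWord i j (M i j)) =
          cs.wordProd (alternatingWord i j (M i j - 1)) * cs.simple i := by
        have h1 := cs.wordProd_braidWord_eq i j
        rw [braidWord, braidWord, M.symmetric j i] at h1
        rw [h1]
        conv_lhs => rw [← Nat.sub_add_cancel h0]
        rw [alternatingWord_succ, cs.wordProd_concat]
      rw [e, ← mul_assoc] at hv
      rw [CoxeterSystem.IsRightDescent, hv, cs.simple_mul_simple_cancel_right, ← hv]
      have h1 := cs.length_mul_le v (cs.wordProd (alternatingWord i j (M i j - 1)))
      have h2 := hlen (M i j - 1)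
      omega
  obtain ⟨v, hv, hl⟩ := hPk
  have hnext : ¬ cs.IsRightDescent v (if Even k then j else i) := by
    intro hd
    apply hPk1
    refine ⟨v * cs.simple (if Even k then j else i), ?_, ?_⟩
    · rw [alternatingWord_succ', cs.wordProd_cons, ← mul_assoc,
        cs.simple_mul_simple_cancel_right, ← hv]
    · have := cs.isRightDescent_iff.1 hd
      omega
  obtain ⟨k', hk'⟩ : ∃ k', k = k' + 1 := ⟨k - 1, by omega⟩
  have hfront : ¬ cs.IsRightDescent v (if Even k' then j else i) := by
    intro hd
    rw [hk', alternatingWord_succ', cs.wordProd_cons, ← mul_assoc] at hv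
    have h1 := cs.length_mul_le (v * cs.simple (if Even k' then j else i))
      (cs.wordProd (alternatingWord i j k'))
    have h2 := hlen k'
    rw [← hv] at h1
    unfold CoxeterSystem.IsRightDescent at hd
    omega
  have hvi : ¬ cs.IsRightDescent v i ∧ ¬ cs.IsRightDescent v j := by
    by_cases he : Even k'
    · have : ¬ Even k := by rw [hk', Nat.even_add_one]; exact not_not.2 he
      rw [if_neg this] at hnext
      rw [if_pos he] at hfront
      exact ⟨hnext, hfront⟩
    · have : Even k := by rw [hk', Nat.even_add_one]; exact he
      rw [if_pos this] at hnext
      rw [if_neg he] at hfront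
      exact ⟨hfront, hnext⟩
  have h1 := IH (cs.length v) (by omega) v i hvi.1 rfl
  have h2 := IH (cs.length v) (by omega) v j hvi.2 rfl
  have c1 : 0 ≤ chebSeq (-2 * gram M i j) k := chebSeq_nonneg hij (hkm.imp_right (by omega))
  have c2 : 0 ≤ chebSeq (-2 * gram M i j) (k + 1) := chebSeq_nonneg hij hkm
  rw [hv, geom_mul_apply, geom_alternatingWord]
  split_ifs <;> simp only [map_add, map_smul] <;>
    exact add_nonneg (smul_nonneg (by assumption) h1) (smul_nonneg (by assumption) h2)

end Geometry

section Reduced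

variable {cs : CoxeterSystem M W}

lemma isReduced_append_left {a b : List B} (h : cs.IsReduced (a ++ b)) : cs.IsReduced a := by
  simpa using h.take a.length

lemma isReduced_append_right {a b : List B} (h : cs.IsReduced (a ++ b)) : cs.IsReduced b := by
  simpa using h.drop a.length

lemma isReduced_of_cons {s : B} {a : List B} (h : cs.IsReduced (s :: a)) : cs.IsReduced a :=
  isReduced_append_right (a := [s]) h

lemma isReduced_concat_iff {a : List B} {i : B} :
    cs.IsReduced (a ++ [i]) ↔ cs.IsReduced a ∧ ¬ cs.IsRightDescent (cs.wordProd a) i := by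
  constructor
  · intro h
    have h1 := isReduced_append_left h
    refine ⟨h1, ?_⟩
    rw [cs.not_isRightDescent_iff, ← cs.wordProd_singleton, ← cs.wordProd_append, h, h1]
    simp
  · rintro ⟨h1, h2⟩
    rw [cs.not_isRightDescent_iff, ← cs.wordProd_singleton, ← cs.wordProd_append, h1] at h2
    rw [CoxeterSystem.IsReduced, h2]
    simp

lemma isReduced_cons_iff {a : List B} {i : B} :
    cs.IsReduced (i :: a) ↔ cs.IsReduced a ∧ ¬ cs.IsLeftDescent (cs.wordProd a) i := by
  rw [← cs.isReduced_reverse_iff, List.reverse_cons, isReduced_concat_iff,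
    cs.isReduced_reverse_iff, cs.wordProd_reverse, cs.isRightDescent_inv_iff]

end Reduced

section Roots

variable [Fintype B] [DecidableEq B] (cs : CoxeterSystem M W)

/-- The root system: the orbit of the simple roots. -/
def IsRoot (β : B → ℝ) : Prop := ∃ g i, β = geom cs g (simpleRoot i)

variable {cs}

lemma isRoot_simpleRoot (i : B) : IsRoot cs (simpleRoot i) := ⟨1, i, by simp⟩

lemma IsRoot.geom_apply {β : B → ℝ} (h : IsRoot cs β) (g : W) : IsRoot cs (geom cs g β) := by
  obtain ⟨v, i, rfl⟩ := h
  exact ⟨g * v, i, (geom_mul_apply cs g v _).symm⟩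

lemma IsRoot.simpleRefl_apply {β : B → ℝ} (h : IsRoot cs β) (i : B) :
    IsRoot cs (simpleRefl M i β) := by
  rw [← geom_simple cs]
  exact h.geom_apply _

lemma IsRoot.neg {β : B → ℝ} (h : IsRoot cs β) : IsRoot cs (-β) := by
  obtain ⟨v, i, rfl⟩ := h
  refine ⟨v * cs.simple i, i, ?_⟩
  rw [geom_mul_apply, geom_simple, simpleRefl_self, map_neg]

lemma IsRoot.form_self {β : B → ℝ} (h : IsRoot cs β) : form M β β = 1 := by
  obtain ⟨v, i, rfl⟩ := h
  rw [form_geom, form_simpleRoot, gram_self]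

lemma IsRoot.eq_zero_of_le_of_le {β : B → ℝ} (h : IsRoot cs β) (h1 : 0 ≤ β) (h2 : β ≤ 0) :
    False := by
  have := h.form_self
  rw [le_antisymm h2 h1] at this
  simp at this

lemma IsRoot.sub_smul {β γ : B → ℝ} (hβ : IsRoot cs β) (hγ : IsRoot cs γ) :
    IsRoot cs (γ - (2 * form M β γ) • β) := by
  obtain ⟨g, i, rfl⟩ := hβ
  convert hγ.geom_apply (g * cs.simple i * g⁻¹) using 1
  rw [geom_mul_apply, geom_mul_apply, geom_simple, CambrianPaper.simpleRefl_apply, map_sub,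
    map_smul, geom_apply_inv_self, ← form_geom cs g (simpleRoot i), geom_apply_inv_self]

lemma geom_simpleRoot_nonpos {w : W} {i : B} (h : cs.IsRightDescent w i) :
    geom cs w (simpleRoot i) ≤ 0 := by
  have h1 := geom_simpleRoot_nonneg cs (w * cs.simple i) i
    (cs.isRightDescent_iff_not_isRightDescent_mul.1 h)
  rw [geom_mul_apply, geom_simple, simpleRefl_self, map_neg] at h1
  exact neg_nonneg.1 h1

lemma IsRoot.nonneg_or_nonpos {β : B → ℝ} (h : IsRoot cs β) : 0 ≤ β ∨ β ≤ 0 := by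
  obtain ⟨v, i, rfl⟩ := h
  by_cases hd : cs.IsRightDescent v i
  · exact Or.inr (geom_simpleRoot_nonpos hd)
  · exact Or.inl (geom_simpleRoot_nonneg cs v i hd)

lemma geom_simpleRoot_nonpos_iff {w : W} {i : B} :
    geom cs w (simpleRoot i) ≤ 0 ↔ cs.IsRightDescent w i := by
  refine ⟨fun h => ?_, geom_simpleRoot_nonpos⟩
  by_contra hd
  exact ((isRoot_simpleRoot i).geom_apply w).eq_zero_of_le_of_le
    (geom_simpleRoot_nonneg cs w i hd) h

lemma geom_eq_one {g : W} (h : geom cs g = 1) : g = 1 := by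
  by_contra hg
  obtain ⟨i, hi⟩ := cs.exists_rightDescent_of_ne_one hg
  have h1 := geom_simpleRoot_nonpos hi
  rw [h] at h1
  exact (isRoot_simpleRoot (cs := cs) i).eq_zero_of_le_of_le (simpleRoot_nonneg i) h1

lemma IsRoot.eq_simpleRoot {β : B → ℝ} (h : IsRoot cs β) (h0 : 0 ≤ β) {s : B}
    (hs : ∀ j, j ≠ s → β j = 0) : β = simpleRoot s := by
  have e : β = β s • simpleRoot s := by
    funext j
    rcases eq_or_ne j s with rfl | hj
    · simp [simpleRoot]
    · simp [simpleRoot, hs j hj, hj]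
  have h1 := h.form_self
  rw [e] at h1
  simp only [map_smul, LinearMap.smul_apply, form_simpleRoot, gram_self, smul_eq_mul, mul_one] at h1
  have h2 : β s = 1 := by nlinarith [h0 s, show (0 : B → ℝ) s = 0 from rfl]
  rw [e, h2, one_smul]

lemma simpleRefl_apply_of_ne {s j : B} (h : j ≠ s) (x : B → ℝ) : simpleRefl M s x j = x j := by
  simp [CambrianPaper.simpleRefl_apply, simpleRoot, h]

lemma IsRoot.simpleRefl_nonneg {β : B → ℝ} (h : IsRoot cs β) (h0 : 0 ≤ β) {s : B}
    (hs : β ≠ simpleRoot s) : 0 ≤ simpleRefl M s β := by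
  rcases (h.simpleRefl_apply s).nonneg_or_nonpos with h1 | h1
  · exact h1
  · refine absurd (h.eq_simpleRoot h0 fun j hj => le_antisymm ?_ (h0 j)) hs
    have := h1 j
    rwa [simpleRefl_apply_of_ne hj] at this

lemma IsRoot.simpleRefl_nonpos {β : B → ℝ} (h : IsRoot cs β) (h0 : β ≤ 0) {s : B}
    (hs : β ≠ -simpleRoot s) : simpleRefl M s β ≤ 0 := by
  have := h.neg.simpleRefl_nonneg (neg_nonneg.2 h0) (s := s) (by rwa [Ne, neg_eq_iff_eq_neg])
  rw [map_neg] at this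
  exact neg_nonneg.1 this

lemma simpleRefl_simpleRefl (s : B) (x : B → ℝ) : simpleRefl M s (simpleRefl M s x) = x := by
  rw [← Module.End.mul_apply, simpleRefl_mul_self, Module.End.one_apply]

variable (M) in
/-- The sequence of roots attached to a word. -/
def roots : List B → List (B → ℝ)
  | [] => []
  | s :: a => simpleRoot s :: (roots a).map (simpleRefl M s)

lemma roots_append (a b : List B) :
    roots M (a ++ b) = roots M a ++ (roots M b).map (geom cs (cs.wordProd a)) := by
  induction a with
  | nil =>
    rw [cs.wordProd_nil, map_one]
    exact (List.map_id _).symm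
  | cons s a ih =>
    simp only [List.cons_append, roots, ih, List.map_append, List.map_map, cs.wordProd_cons]
    congr 2
    refine List.map_congr_left fun x _ => ?_
    simp [geom_simple]

lemma roots_concat (a : List B) (i : B) :
    roots M (a ++ [i]) = roots M a ++ [geom cs (cs.wordProd a) (simpleRoot i)] := by
  rw [roots_append (cs := cs)]
  simp [roots]

lemma mem_roots_iff {a : List B} (ha : cs.IsReduced a) {β : B → ℝ} :
    β ∈ roots M a ↔ IsRoot cs β ∧ 0 ≤ β ∧ geom cs (cs.wordProd a)⁻¹ β ≤ 0 := by
  induction a using List.reverseRecOn with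
  | nil =>
    simp only [roots, List.not_mem_nil, cs.wordProd_nil, inv_one, map_one, Module.End.one_apply,
      false_iff]
    rintro ⟨h, h1, h2⟩
    exact h.eq_zero_of_le_of_le h1 h2
  | append_singleton a i ih =>
    obtain ⟨ha1, ha2⟩ := isReduced_concat_iff.1 ha
    have hpos := geom_simpleRoot_nonneg cs _ _ ha2
    have hroot : IsRoot cs (geom cs (cs.wordProd a) (simpleRoot i)) := ⟨_, _, rfl⟩
    rw [roots_concat (cs := cs), List.mem_append, List.mem_singleton, ih ha1, cs.wordProd_append,
      cs.wordProd_singleton, mul_inv_rev, cs.inv_simple, geom_mul_apply, geom_simple]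
    constructor
    · rintro (⟨h1, h2, h3⟩ | rfl)
      · refine ⟨h1, h2, (h1.geom_apply _).simpleRefl_nonpos h3 fun h4 => ?_⟩
        apply h1.eq_zero_of_le_of_le h2
        rw [← geom_apply_inv_self cs (cs.wordProd a) β, h4, map_neg]
        exact neg_nonpos.2 hpos
      · refine ⟨hroot, hpos, ?_⟩
        rw [geom_inv_apply_self, simpleRefl_self]
        exact neg_nonpos.2 (simpleRoot_nonneg i)
    · rintro ⟨h1, h2, h3⟩
      rcases (h1.geom_apply (cs.wordProd a)⁻¹).nonneg_or_nonpos with h4 | h4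
      · right
        by_contra hne
        refine ((h1.geom_apply (cs.wordProd a)⁻¹).simpleRefl_apply i).eq_zero_of_le_of_le
          ((h1.geom_apply _).simpleRefl_nonneg h4 fun h5 => hne ?_) h3
        rw [← h5, geom_apply_inv_self]
      · exact Or.inl ⟨h1, h2, h4⟩

lemma geom_inv_nonneg_of_notMem_roots {a : List B} (ha : cs.IsReduced a) {β : B → ℝ}
    (h : IsRoot cs β) (h0 : 0 ≤ β) (hβ : β ∉ roots M a) : 0 ≤ geom cs (cs.wordProd a)⁻¹ β := by
  rcases (h.geom_apply (cs.wordProd a)⁻¹).nonneg_or_nonpos with h1 | h1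
  · exact h1
  · exact absurd ((mem_roots_iff ha).2 ⟨h, h0, h1⟩) hβ

lemma simpleRoot_mem_roots_iff {a : List B} (ha : cs.IsReduced a) {s : B} :
    simpleRoot s ∈ roots M a ↔ cs.IsLeftDescent (cs.wordProd a) s := by
  rw [mem_roots_iff ha, geom_simpleRoot_nonpos_iff, cs.isRightDescent_inv_iff]
  exact ⟨fun h => h.2.2, fun h => ⟨isRoot_simpleRoot s, simpleRoot_nonneg s, h⟩⟩

lemma roots_apply_of_notMem {a : List B} {s : B} (hs : s ∉ a) {x : B → ℝ} (hx : x ∈ roots M a) :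
    x s = 0 := by
  induction a generalizing x with
  | nil => simp [roots] at hx
  | cons t a ih =>
    simp only [List.mem_cons, not_or] at hs
    simp only [roots, List.mem_cons, List.mem_map] at hx
    rcases hx with rfl | ⟨y, hy, rfl⟩
    · simp [simpleRoot, hs.1]
    · rw [simpleRefl_apply_of_ne hs.1, ih hs.2 hy]

lemma geom_wordProd_apply_of_notMem {a : List B} {s : B} (hs : s ∉ a) (x : B → ℝ) :
    geom cs (cs.wordProd a) x s = x s := by
  induction a with
  | nil => simp
  | cons t a ih =>
    simp only [List.mem_cons, not_or] at hs
    rw [cs.wordProd_cons, geom_mul_apply, geom_simple, simpleRefl_apply_of_ne hs.1, ih hs.2]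

lemma simpleRoot_notMem_roots {a : List B} {s : B} (hs : s ∉ a) : simpleRoot s ∉ roots M a := by
  intro h
  have := roots_apply_of_notMem hs h
  simp [simpleRoot] at this

/-- Compatibility of a pairwise relation on the roots of a reduced word with convex combinations. -/
lemma rel_of_mem_roots_of_eq_add {a : List B} (ha : cs.IsReduced a) {R : (B → ℝ) → (B → ℝ) → Prop}
    (hR : (roots M a).Pairwise R) {p q y : B → ℝ} (hp : p ∈ roots M a) (hq : q ∈ roots M a)
    (hpq : p ≠ q) (hy : IsRoot cs y) (hy0 : 0 ≤ y) (hya : y ∉ roots M a) {k l : ℝ} (hk : 0 ≤ k)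
    (hl : 0 ≤ l) (h : q = k • p + l • y) : R p q := by
  induction a using List.reverseRecOn with
  | nil => simp [roots] at hp
  | append_singleton a i ih =>
    have hha := (isReduced_concat_iff.1 ha).1
    by_cases hq1 : q ∈ roots M a
    · by_cases hp1 : p ∈ roots M a
      · rw [roots_concat (cs := cs)] at hR hya
        exact ih hha (List.pairwise_append.1 hR).1 hp1 hq1 fun hh =>
          hya (List.mem_append_left _ hh)
      · exfalso
        have hpr := (mem_roots_iff ha).1 hp
        have hqr := (mem_roots_iff hha).1 hq1
        have h1 := geom_inv_nonneg_of_notMem_roots hha hpr.1 hpr.2.1 hp1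
        have h2 := geom_inv_nonneg_of_notMem_roots hha hy hy0 fun hh => hya (by
          rw [roots_concat (cs := cs)]
          exact List.mem_append_left _ hh)
        refine (hqr.1.geom_apply (cs.wordProd a)⁻¹).eq_zero_of_le_of_le ?_ hqr.2.2
        rw [h, map_add, map_smul, map_smul]
        exact add_nonneg (smul_nonneg hk h1) (smul_nonneg hl h2)
    · rw [roots_concat (cs := cs)] at hR hp hq
      simp only [List.mem_append, List.mem_singleton] at hp hq
      rcases hq with hq | hq
      · exact absurd hq hq1
      rcases hp with hp | hp
      · exact (List.pairwise_append.1 hR).2.2 p hp q (by simp [hq])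
      · exact absurd (hp.trans hq.symm) hpq

end Roots

section EulerForm

set_option linter.unusedSectionVars false

variable [Fintype B] [DecidableEq B]

variable (M) in
/-- The off-diagonal part of the form, restricted to the letters of a list. -/
def offDiag (c : List B) (s : B) (x : B → ℝ) : ℝ := (c.map fun j => -gram M s j * x j).sum

variable (M) in
/-- The skew-symmetric form attached to the orientation of the Coxeter graph given by a word. -/
def skewForm : List B → (B → ℝ) → (B → ℝ) → ℝ
  | [], _, _ => 0
  | s :: c, x, y => skewForm c x y + (x s * offDiag M c s y - y s * offDiag M c s x)

lemma offDiag_cons (t : B) (c : List B) (s : B) (x : B → ℝ) :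
    offDiag M (t :: c) s x = -gram M s t * x t + offDiag M c s x := by
  simp [offDiag]

lemma offDiag_append (c d : List B) (s : B) (x : B → ℝ) :
    offDiag M (c ++ d) s x = offDiag M c s x + offDiag M d s x := by
  simp [offDiag]

lemma offDiag_reverse (c : List B) (s : B) (x : B → ℝ) :
    offDiag M c.reverse s x = offDiag M c s x := by
  simp [offDiag, List.map_reverse, List.sum_reverse]

lemma offDiag_congr {c : List B} (s : B) {x y : B → ℝ} (h : ∀ j ∈ c, x j = y j) :
    offDiag M c s x = offDiag M c s y := by
  unfold offDiag
  congr 1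
  exact List.map_congr_left fun j hj => by rw [h j hj]

lemma offDiag_add (c : List B) (s : B) (x y : B → ℝ) :
    offDiag M c s (x + y) = offDiag M c s x + offDiag M c s y := by
  induction c with
  | nil => simp [offDiag]
  | cons t c ih =>
    simp only [offDiag_cons, ih, Pi.add_apply]
    ring

lemma offDiag_smul (c : List B) (s : B) (k : ℝ) (x : B → ℝ) :
    offDiag M c s (k • x) = k * offDiag M c s x := by
  induction c with
  | nil => simp [offDiag]
  | cons t c ih =>
    simp only [offDiag_cons, ih, Pi.smul_apply, smul_eq_mul]
    ring

lemma offDiag_nonneg {c : List B} {s : B} (hs : s ∉ c) {x : B → ℝ} (hx : 0 ≤ x) :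
    0 ≤ offDiag M c s x := by
  apply List.sum_nonneg
  intro r hr
  obtain ⟨j, hj, rfl⟩ := List.mem_map.1 hr
  have hsj : s ≠ j := by
    rintro rfl
    exact hs hj
  exact mul_nonneg (neg_nonneg.2 (gram_nonpos hsj)) (hx j)

lemma offDiag_eq {c : List B} {s : B} (hc : (s :: c).Nodup) (hall : ∀ b, b ∈ s :: c)
    (x : B → ℝ) : offDiag M c s x = x s - form M (simpleRoot s) x := by
  have h1 : form M (simpleRoot s) x = ((s :: c).map fun j => gram M s j * x j).sum := by
    have hu : (s :: c).toFinset = Finset.univ := by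
      ext b
      simpa using hall b
    rw [← List.sum_toFinset _ hc, hu]
    simp only [form, simpleRoot, Matrix.toBilin'_apply]
    rw [Finset.sum_eq_single s]
    · simp
    · intro j _ hj
      simp [hj]
    · simp
  have h2 : offDiag M c s x = -(c.map fun j => gram M s j * x j).sum := by
    clear h1 hc hall
    induction c with
    | nil => simp [offDiag]
    | cons t c ih =>
      rw [offDiag_cons, ih]
      simp only [List.map_cons, List.sum_cons]
      ring
  rw [h1, h2, List.map_cons, List.sum_cons, gram_self]
  ring

lemma skewForm_skew (c : List B) (x y : B → ℝ) : skewForm M c x y = -skewForm M c y x := by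
  induction c with
  | nil => simp [skewForm]
  | cons s c ih =>
    simp only [skewForm, ih]
    ring

lemma skewForm_self (c : List B) (x : B → ℝ) : skewForm M c x x = 0 := by
  linarith [skewForm_skew (M := M) c x x]

lemma skewForm_add_right (c : List B) (x y z : B → ℝ) :
    skewForm M c x (y + z) = skewForm M c x y + skewForm M c x z := by
  induction c with
  | nil => simp [skewForm]
  | cons s c ih =>
    simp only [skewForm, ih, offDiag_add, Pi.add_apply]
    ring

lemma skewForm_smul_right (c : List B) (k : ℝ) (x y : B → ℝ) :
    skewForm M c x (k • y) = k * skewForm M c x y := by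
  induction c with
  | nil => simp [skewForm]
  | cons s c ih =>
    simp only [skewForm, ih, offDiag_smul, Pi.smul_apply, smul_eq_mul]
    ring

lemma skewForm_add_left (c : List B) (x y z : B → ℝ) :
    skewForm M c (x + y) z = skewForm M c x z + skewForm M c y z := by
  rw [skewForm_skew, skewForm_add_right, skewForm_skew c x, skewForm_skew c y]
  ring

lemma skewForm_smul_left (c : List B) (k : ℝ) (x y : B → ℝ) :
    skewForm M c (k • x) y = k * skewForm M c x y := by
  rw [skewForm_skew, skewForm_smul_right, skewForm_skew c x]
  ring

lemma skewForm_congr {c : List B} {x x' y y' : B → ℝ} (hx : ∀ j ∈ c, x j = x' j)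
    (hy : ∀ j ∈ c, y j = y' j) : skewForm M c x y = skewForm M c x' y' := by
  induction c with
  | nil => rfl
  | cons s c ih =>
    simp only [List.mem_cons, forall_eq_or_imp] at hx hy
    simp only [skewForm, ih hx.2 hy.2, hx.1, hy.1, offDiag_congr s hx.2, offDiag_congr s hy.2]

lemma skewForm_concat (c : List B) (s : B) (x y : B → ℝ) :
    skewForm M (c ++ [s]) x y =
      skewForm M c x y + (y s * offDiag M c s x - x s * offDiag M c s y) := by
  induction c with
  | nil => simp [skewForm, offDiag]
  | cons t c ih =>
    simp only [List.cons_append, skewForm, ih, offDiag_append, offDiag_cons, gram_symm s t]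
    simp only [offDiag, List.map_nil, List.sum_nil]
    ring

lemma skewForm_reverse (c : List B) (x y : B → ℝ) :
    skewForm M c.reverse x y = -skewForm M c x y := by
  induction c with
  | nil => simp [skewForm]
  | cons s c ih =>
    simp only [List.reverse_cons, skewForm_concat, skewForm, ih, offDiag_reverse]
    ring

lemma skewForm_cons_eq_concat {c : List B} {s : B} (hc : (s :: c).Nodup)
    (hall : ∀ b, b ∈ s :: c) (x y : B → ℝ) :
    skewForm M (s :: c) x y = skewForm M (c ++ [s]) x y +
      2 * (y s * form M (simpleRoot s) x - x s * form M (simpleRoot s) y) := by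
  rw [skewForm_concat, skewForm, offDiag_eq hc hall, offDiag_eq hc hall]
  ring

lemma skewForm_simpleRoot_left {c : List B} {s : B} (hs : s ∉ c) (y : B → ℝ) :
    skewForm M (s :: c) (simpleRoot s) y = offDiag M c s y := by
  have h0 : ∀ j ∈ c, (simpleRoot s : B → ℝ) j = (0 : B → ℝ) j := by
    intro j hj
    have : j ≠ s := by
      rintro rfl
      exact hs hj
    simp [simpleRoot, this]
  have h1 : skewForm M c (simpleRoot s) y = 0 := by
    rw [skewForm_congr h0 (fun _ _ => rfl), ← zero_smul ℝ (0 : B → ℝ), skewForm_smul_left, zero_mul]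
  have h2 : offDiag M c s (simpleRoot s) = 0 := by
    rw [offDiag_congr s h0, ← zero_smul ℝ (0 : B → ℝ), offDiag_smul, zero_mul]
  rw [skewForm, h1, h2]
  simp [simpleRoot]

lemma skewForm_simpleRefl {c : List B} {s : B} (hc : (s :: c).Nodup)
    (hall : ∀ b, b ∈ s :: c) (x y : B → ℝ) :
    skewForm M (c ++ [s]) (simpleRefl M s x) (simpleRefl M s y) = skewForm M (s :: c) x y := by
  have h (z : B → ℝ) : ∀ j ∈ c, simpleRefl M s z j = z j := by
    intro j hj
    apply simpleRefl_apply_of_ne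
    rintro rfl
    exact (List.nodup_cons.1 hc).1 hj
  have e (z : B → ℝ) : simpleRefl M s z s = z s - 2 * form M (simpleRoot s) z := by
    simp [simpleRefl_apply, simpleRoot]
  rw [skewForm_concat, skewForm_congr (h x) (h y), offDiag_congr s (h x), offDiag_congr s (h y),
    e, e, skewForm, offDiag_eq hc hall, offDiag_eq hc hall]
  ring

end EulerForm

section NestedWords

/-- Words that factor as a product of a nested sequence of subwords of `c`. -/
inductive NestedWord : List B → List B → Prop
  | nil (c : List B) : NestedWord c []
  | append {c d a : List B} (hd : d.Sublist c) (h : NestedWord d a) : NestedWord c (d ++ a)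

lemma NestedWord.subset {c a : List B} (h : NestedWord c a) : a ⊆ c := by
  induction h with
  | nil => simp
  | append hd _ ih => exact List.append_subset.2 ⟨hd.subset, List.Subset.trans ih hd.subset⟩

lemma NestedWord.mono {c d a : List B} (h : NestedWord c a) (hcd : c.Sublist d) :
    NestedWord d a := by
  cases h with
  | nil => exact .nil d
  | append hd h => exact .append (hd.trans hcd) h

lemma sublist_append_of_notMem {t : B} {d p q : List B} (h : d.Sublist (p ++ t :: q)) (ht : t ∉ d) :
    d.Sublist (p ++ q) := by
  obtain ⟨d₁, d₂, rfl, h1, h2⟩ := List.sublist_append_iff.1 h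
  refine h1.append ?_
  rcases List.sublist_cons_iff.1 h2 with h3 | ⟨r, rfl, -⟩
  · exact h3
  · simp at ht

lemma NestedWord.of_notMem {t : B} {p q a : List B} (h : NestedWord (p ++ t :: q) a)
    (ht : t ∉ a) : NestedWord (p ++ q) a := by
  cases h with
  | nil => exact .nil _
  | append hd h =>
    exact .append (sublist_append_of_notMem hd fun hh => ht (List.mem_append_left _ hh)) h

lemma NestedWord.erase {c p q : List B} {t : B} (h : NestedWord c (p ++ t :: q)) (ht : t ∉ q) :
    NestedWord c (p ++ q) := by
  generalize ha : p ++ t :: q = a at h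
  induction h generalizing p with
  | nil => simp at ha
  | @append c d a hd h ih =>
    rcases List.append_eq_append_iff.1 ha with ⟨e, rfl, he⟩ | ⟨e, rfl, he⟩
    · rcases List.cons_eq_append_iff.1 he with ⟨rfl, rfl⟩ | ⟨e', rfl, rfl⟩
      · simpa using NestedWord.append hd (ih (p := []) rfl)
      · rw [← List.append_assoc]
        refine .append (.trans ?_ hd) (h.of_notMem fun hh => ht (List.mem_append_right _ hh))
        exact (List.Sublist.refl p).append (List.sublist_cons_self t e')
    · rw [List.append_assoc]
      exact .append hd (ih he.symm)

lemma NestedWord.cons_cases {s : B} {c a : List B} (h : NestedWord (s :: c) a)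
    (hs : s ∉ c) :
    (∃ b, a = s :: b ∧ NestedWord (c ++ [s]) b) ∨ (s ∉ a ∧ NestedWord c a) := by
  generalize hL : s :: c = L at h
  induction h generalizing c with
  | nil => exact Or.inr ⟨by simp, .nil _⟩
  | @append L d a hd h ih =>
    subst hL
    rcases List.sublist_cons_iff.1 hd with h1 | ⟨d', rfl, h1⟩
    · have h2 := NestedWord.append h1 h
      exact Or.inr ⟨fun hh => hs (h2.subset hh), h2⟩
    · refine Or.inl ⟨d' ++ a, rfl, ?_⟩
      rcases ih (c := d') (fun hh => hs (h1.subset hh)) rfl with ⟨b, rfl, h2⟩ | ⟨-, h2⟩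
      · have h3 := NestedWord.append (h1.append (List.Sublist.refl [s])) h2
        simpa using h3
      · exact .append (h1.trans (List.sublist_append_left _ _)) h2

lemma NestedWord.cons_of_concat {s : B} {c a : List B} (h : NestedWord (c ++ [s]) a) :
    NestedWord (s :: c) (s :: a) := by
  generalize hL : c ++ [s] = L at h
  induction h generalizing c with
  | nil => exact .append (d := [s]) (by simp) (.nil _)
  | @append L d a hd h ih =>
    subst hL
    obtain ⟨d₁, d₂, rfl, h1, h2⟩ := List.sublist_append_iff.1 hd
    rcases List.sublist_singleton.1 h2 with rfl | rfl
    · rw [List.append_nil] at h ⊢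
      exact .append (d := s :: d₁) (h1.cons_cons s) (h.mono (List.sublist_cons_self _ _))
    · have h3 := NestedWord.append (h1.cons_cons s) (ih rfl)
      simpa using h3

/-- Induction along the rotations of `c`. -/
theorem rotation_induction [DecidableEq B] {P : List B → List B → Prop} (hnil : ∀ c, P c [])
    (hstep : ∀ s c a, (s :: c).Nodup → (∀ b, b ∈ s :: c) →
      (∀ a', a'.length < a.length → P (c ++ [s]) a') →
      (a.head? ≠ some s → P (c ++ [s]) a) → P (s :: c) a) :
    ∀ c a : List B, c.Nodup → (∀ b, b ∈ c) → P c a := by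
  intro c a
  induction hn : a.length using Nat.strong_induction_on generalizing c a with
  | _ n ih =>
  subst hn
  intro hc hall
  rcases a with _ | ⟨t, a⟩
  · exact hnil c
  induction hk : c.idxOf t using Nat.strong_induction_on generalizing c with
  | _ k ihk =>
  subst hk
  rcases c with _ | ⟨s, c⟩
  · exact absurd (hall t) (by simp)
  have hc2 : (c ++ [s]).Nodup := by
    rw [← List.singleton_append] at hc
    exact List.nodup_append_comm.1 hc
  have hall2 : ∀ b, b ∈ c ++ [s] := fun b => by
    have := hall b
    simp only [List.mem_cons, List.mem_append, List.not_mem_nil, or_false] at this ⊢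
    exact this.symm
  refine hstep s c _ hc hall (fun a' ha' => ih _ ha' _ a' rfl hc2 hall2) fun hst => ?_
  have hst' : s ≠ t := fun h => hst (by simp [h])
  refine ihk _ ?_ _ hc2 hall2 rfl
  have htc : t ∈ c := by simpa [hst'.symm] using hall t
  rw [List.idxOf_append_of_mem htc, List.idxOf_cons_ne _ hst']
  exact Nat.lt_succ_self _

end NestedWords

section Sorting

variable (cs : CoxeterSystem M W)

lemma pass_nil (u : W) : pass cs [] u = ([], u) := rfl

lemma pass_cons (q : B) (c : List B) (u : W) :
    pass cs (q :: c) u = if cs.length (cs.simple q * u) < cs.length u then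
      (q :: (pass cs c (cs.simple q * u)).1, (pass cs c (cs.simple q * u)).2)
    else pass cs c u := by
  have key : ∀ (c l : List B) (u : W),
      c.foldl (fun p q =>
        if cs.length (cs.simple q * p.2) < cs.length p.2 then (p.1 ++ [q], cs.simple q * p.2)
        else p) (l, u) = (l ++ (pass cs c u).1, (pass cs c u).2) := by
    intro c
    induction c with
    | nil => simp [pass]
    | cons q c ih =>
      intro l u
      simp only [pass, List.foldl_cons]
      split_ifs
      · rw [ih, ih]
        simp
      · rw [ih, ih]
        simp
  rw [pass, List.foldl_cons]
  simp only
  split_ifs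
  · rw [key]
    simp
  · rfl

lemma pass_sublist (c : List B) (u : W) : (pass cs c u).1.Sublist c := by
  induction c generalizing u with
  | nil => simp [pass_nil]
  | cons q c ih =>
    rw [pass_cons]
    split_ifs
    · exact (ih _).cons_cons q
    · exact (ih _).cons q

lemma wordProd_pass_mul (c : List B) (u : W) :
    cs.wordProd (pass cs c u).1 * (pass cs c u).2 = u := by
  induction c generalizing u with
  | nil => simp [pass_nil]
  | cons q c ih =>
    rw [pass_cons]
    split_ifs
    · simp only
      rw [cs.wordProd_cons, mul_assoc, ih, cs.simple_mul_simple_cancel_left]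
    · exact ih u

lemma length_pass_add (c : List B) (u : W) :
    (pass cs c u).1.length + cs.length (pass cs c u).2 = cs.length u := by
  induction c generalizing u with
  | nil => simp [pass_nil]
  | cons q c ih =>
    rw [pass_cons]
    split_ifs with h
    · have h1 := ih (cs.simple q * u)
      have h2 := cs.isLeftDescent_iff.1 h
      simp only [List.length_cons]
      omega
    · exact ih u

lemma not_isLeftDescent_of_pass_eq_nil {c : List B} {u : W} (h : (pass cs c u).1 = []) :
    ∀ q ∈ c, ¬ cs.IsLeftDescent u q := by
  induction c with
  | nil => simp
  | cons q c ih =>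
    rw [pass_cons] at h
    split_ifs at h with hq
    simp only [List.mem_cons, forall_eq_or_imp]
    exact ⟨hq, ih h⟩

lemma length_remainder_le {c : List B} (hall : ∀ b, b ∈ c) (w : W) (n : ℕ) :
    cs.length (remainder cs c w n) ≤ cs.length w - n := by
  induction n with
  | zero => simp [remainder]
  | succ n ih =>
    rw [remainder]
    have h1 := length_pass_add cs c (remainder cs c w n)
    by_cases h : (pass cs c (remainder cs c w n)).1 = []
    · have h2 : remainder cs c w n = 1 := by
        by_contra hne
        obtain ⟨q, hq⟩ := cs.exists_leftDescent_of_ne_one hne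
        exact not_isLeftDescent_of_pass_eq_nil cs h q (hall q) hq
      rw [h2, cs.length_one] at h1
      rw [h2]
      omega
    · have := List.length_pos_iff.2 h
      omega

lemma wordProd_factors_mul (c : List B) (w : W) (n : ℕ) :
    cs.wordProd ((List.range n).map (factor cs c w)).flatten * remainder cs c w n = w := by
  induction n with
  | zero => simp [remainder]
  | succ n ih =>
    rw [List.range_succ, List.map_append, List.flatten_append, cs.wordProd_append, mul_assoc]
    simp only [List.map_cons, List.map_nil, List.flatten_singleton, factor, remainder]
    rw [wordProd_pass_mul]
    exact ih

lemma length_factors_add (c : List B) (w : W) (n : ℕ) :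
    ((List.range n).map (factor cs c w)).flatten.length + cs.length (remainder cs c w n) =
      cs.length w := by
  induction n with
  | zero => simp [remainder]
  | succ n ih =>
    rw [List.range_succ, List.map_append, List.flatten_append, List.length_append]
    simp only [List.map_cons, List.map_nil, List.flatten_singleton, factor, remainder]
    have := length_pass_add cs c (remainder cs c w n)
    omega

lemma wordProd_sortingWord {c : List B} (hall : ∀ b, b ∈ c) (w : W) :
    cs.wordProd (sortingWord cs c w) = w := by
  have h := wordProd_factors_mul cs c w (cs.length w)
  have h1 := length_remainder_le cs hall w (cs.length w)
  rw [Nat.sub_self, Nat.le_zero, cs.length_eq_zero_iff] at h1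
  rwa [h1, mul_one] at h

lemma isReduced_sortingWord {c : List B} (hall : ∀ b, b ∈ c) (w : W) :
    cs.IsReduced (sortingWord cs c w) := by
  have h := length_factors_add cs c w (cs.length w)
  have h1 := length_remainder_le cs hall w (cs.length w)
  rw [CoxeterSystem.IsReduced, wordProd_sortingWord cs hall, ← h, sortingWord]
  omega

lemma sublist_of_subset_of_sublist {c l₁ l₂ : List B} (hc : c.Nodup) (h1 : l₁.Sublist c)
    (h2 : l₂.Sublist c) (h : l₁ ⊆ l₂) : l₁.Sublist l₂ := by
  induction c generalizing l₁ l₂ with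
  | nil =>
    rw [List.sublist_nil.1 h1]
    exact List.nil_sublist _
  | cons x c ih =>
    obtain ⟨hx, hc⟩ := List.nodup_cons.1 hc
    rcases List.sublist_cons_iff.1 h1 with h3 | ⟨r₁, rfl, h3⟩ <;>
      rcases List.sublist_cons_iff.1 h2 with h4 | ⟨r₂, rfl, h4⟩
    · exact ih hc h3 h4 h
    · refine (ih hc h3 h4 fun y hy => ?_).cons x
      refine (List.mem_cons.1 (h hy)).resolve_left ?_
      rintro rfl
      exact hx (h3.subset hy)
    · exact absurd (h4.subset (h List.mem_cons_self)) hx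
    · refine (ih hc h3 h4 fun y hy => ?_).cons_cons x
      refine (List.mem_cons.1 (h (List.mem_cons_of_mem _ hy))).resolve_left ?_
      rintro rfl
      exact hx (h3.subset hy)

lemma IsSortable.nestedWord {cs : CoxeterSystem M W} {c : List B} (hc : c.Nodup) {w : W}
    (h : IsSortable cs c w) : NestedWord c (sortingWord cs c w) := by
  have key : ∀ k n c', (factor cs c w n).Sublist c' →
      NestedWord c' ((List.range' n k).map (factor cs c w)).flatten := by
    intro k
    induction k with
    | zero => exact fun _ _ _ => .nil _
    | succ k ih =>
      intro n c' hn
      rw [List.range'_succ, List.map_cons, List.flatten_cons]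
      exact .append hn (ih (n + 1) _ (sublist_of_subset_of_sublist hc (pass_sublist _ _ _)
        (pass_sublist _ _ _) (h n)))
  rw [sortingWord, List.range_eq_range']
  exact key _ _ _ (pass_sublist _ _ _)

lemma remainder_succ (c : List B) (w : W) (n : ℕ) :
    remainder cs c w (n + 1) = remainder cs c (pass cs c w).2 n := by
  induction n with
  | zero => rfl
  | succ n ih => rw [remainder, ih, remainder]

lemma factor_succ (c : List B) (w : W) (n : ℕ) :
    factor cs c w (n + 1) = factor cs c (pass cs c w).2 n := by
  rw [factor, remainder_succ, factor]

lemma isSortable_of_pass {c : List B} {w : W} (h0 : (pass cs c (pass cs c w).2).1 ⊆ (pass cs c w).1)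
    (h : IsSortable cs c (pass cs c w).2) : IsSortable cs c w := by
  rintro (_ | n) q hq
  · exact h0 hq
  · rw [factor_succ] at hq ⊢
    exact h n q hq

variable [Fintype B] [DecidableEq B]

lemma not_isLeftDescent_of_notMem {a : List B} (ha : cs.IsReduced a) {s : B} (hs : s ∉ a) :
    ¬ cs.IsLeftDescent (cs.wordProd a) s := by
  rw [← simpleRoot_mem_roots_iff ha]
  exact simpleRoot_notMem_roots hs

lemma pass_wordProd_append {c d a : List B} (hc : c.Nodup) (hd : d.Sublist c)
    (hr : cs.IsReduced (d ++ a)) (ha : ∀ x ∈ c, x ∉ d → x ∉ a) :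
    pass cs c (cs.wordProd (d ++ a)) = (d, cs.wordProd a) := by
  induction c generalizing d with
  | nil =>
    rw [List.sublist_nil.1 hd]
    rfl
  | cons q c ih =>
    obtain ⟨hq, hc⟩ := List.nodup_cons.1 hc
    rw [pass_cons]
    rcases List.sublist_cons_iff.1 hd with hdc | ⟨e, rfl, hdc⟩
    · have hqd : q ∉ d := fun h => hq (hdc.subset h)
      rw [if_neg]
      · exact ih hc hdc hr fun x hx => ha x (List.mem_cons_of_mem _ hx)
      · apply not_isLeftDescent_of_notMem cs hr
        simp [hqd, ha q List.mem_cons_self hqd]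
    · have hr' : cs.IsReduced (e ++ a) := isReduced_of_cons hr
      rw [if_pos]
      · rw [List.cons_append, cs.wordProd_cons, cs.simple_mul_simple_cancel_left, ih hc hdc hr']
        intro x hx hxe
        refine ha x (List.mem_cons_of_mem _ hx) ?_
        rw [List.mem_cons, not_or]
        refine ⟨?_, hxe⟩
        rintro rfl
        exact hq hx
      · rw [List.cons_append, cs.wordProd_cons,
          cs.simple_mul_simple_cancel_left, ← cs.wordProd_cons]
        have h1 := hr.eq
        have h2 := hr'.eq
        rw [List.cons_append, List.length_cons] at h1
        omega

lemma NestedWord.isSortable {c a : List B} (h : NestedWord c a) (hc : c.Nodup)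
    (ha : cs.IsReduced a) : IsSortable cs c (cs.wordProd a) := by
  have key : ∀ c', c'.Nodup → c.Sublist c' →
      IsSortable cs c' (cs.wordProd a) ∧ (pass cs c' (cs.wordProd a)).1 ⊆ a := by
    clear hc
    induction h with
    | nil =>
      intro c' hc' _
      have h1 : pass cs c' 1 = ([], 1) := by
        simpa using pass_wordProd_append cs (a := []) hc' (List.nil_sublist _) ha (by simp)
      have h2 : ∀ n, factor cs c' 1 n = [] := by
        intro n
        induction n with
        | zero => rw [factor, remainder, h1]
        | succ n ih => rw [factor_succ, h1, ih]
      rw [cs.wordProd_nil]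
      refine ⟨fun n q hq => ?_, by simp [h1]⟩
      simp [h2] at hq
    | @append c d a hd h ih =>
      intro c' hc' hcc'
      obtain ⟨h1, h2⟩ := ih (isReduced_append_right ha) c' hc' (hd.trans hcc')
      have h3 := pass_wordProd_append cs hc' (hd.trans hcc') ha
        fun x _ hx hxa => hx (h.subset hxa)
      refine ⟨isSortable_of_pass cs ?_ ?_, ?_⟩
      · rw [h3]
        exact List.Subset.trans h2 h.subset
      · rwa [h3]
      · rw [h3]
        exact List.subset_append_left _ _
  exact (key c hc (List.Sublist.refl c)).1

end Sorting

lemma simple_mul_comm (cs : CoxeterSystem M W) {s t : B} (h : M s t = 2) :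
    cs.simple s * cs.simple t = cs.simple t * cs.simple s := by
  have h1 := cs.simple_mul_simple_pow s t
  rw [h, pow_two, mul_eq_one_iff_eq_inv] at h1
  simpa using h1

section Criterion

set_option linter.unusedSectionVars false

variable [Fintype B] [DecidableEq B] {cs : CoxeterSystem M W}

lemma skewForm_simpleRefl_symm {c : List B} {s : B} (hc : (s :: c).Nodup)
    (hall : ∀ b, b ∈ s :: c) (x y : B → ℝ) :
    skewForm M (s :: c) (simpleRefl M s x) (simpleRefl M s y) = skewForm M (c ++ [s]) x y := by
  rw [← skewForm_simpleRefl hc hall, simpleRefl_simpleRefl, simpleRefl_simpleRefl]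

lemma skewForm_simpleRoot_nonneg {c : List B} {s : B} (hc : (s :: c).Nodup) {y : B → ℝ}
    (hy : 0 ≤ y) : 0 ≤ skewForm M (s :: c) (simpleRoot s) y := by
  have hs := (List.nodup_cons.1 hc).1
  rw [skewForm_simpleRoot_left hs]
  exact offDiag_nonneg hs hy

lemma nonneg_of_mem_roots {a : List B} (ha : cs.IsReduced a) {x : B → ℝ} (hx : x ∈ roots M a) :
    0 ≤ x :=
  ((mem_roots_iff ha).1 hx).2.1

lemma head?_ne_of_notMem {a : List B} {s : B} (hs : s ∉ a) : a.head? ≠ some s :=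
  fun h => hs (List.mem_of_mem_head? h)

theorem NestedWord.pairwise_roots {c a : List B} (h : NestedWord c a) (hc : c.Nodup)
    (hall : ∀ b, b ∈ c) (ha : cs.IsReduced a) :
    (roots M a).Pairwise fun x y => 0 ≤ skewForm M c x y := by
  refine rotation_induction (P := fun c a => NestedWord c a → cs.IsReduced a →
    (roots M a).Pairwise fun x y => 0 ≤ skewForm M c x y) ?_ ?_ c a hc hall h ha
  · intro c _ _
    exact List.Pairwise.nil
  · intro s c a hc hall ih1 ih2 h ha
    rcases h.cons_cases (List.nodup_cons.1 hc).1 with ⟨b, rfl, h1⟩ | ⟨hs, h1⟩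
    · have h2 := ih1 b (by simp) h1 (isReduced_of_cons ha)
      rw [roots, List.pairwise_cons]
      constructor
      · intro y hy
        exact skewForm_simpleRoot_nonneg hc
          (nonneg_of_mem_roots ha (List.mem_cons_of_mem _ hy))
      · rw [List.pairwise_map]
        simpa only [skewForm_simpleRefl_symm hc hall] using h2
    · have h2 := ih2 (head?_ne_of_notMem hs) (h1.mono (List.sublist_append_left _ _)) ha
      refine h2.imp_of_mem fun hx hy hxy => ?_
      rw [skewForm_cons_eq_concat hc hall, roots_apply_of_notMem hs hx,
        roots_apply_of_notMem hs hy]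
      simpa using hxy

lemma exists_perm_cons {s : B} {a : List B} (hs : simpleRoot s ∈ roots M a)
    (h : (roots M a).Pairwise fun x y =>
      y = simpleRoot s → x s - form M (simpleRoot s) x ≤ 0) :
    ∃ b, a.Perm (s :: b) ∧ cs.wordProd a = cs.simple s * cs.wordProd b ∧
      ((roots M b).map (simpleRefl M s)).Sublist (roots M a) := by
  induction a with
  | nil => simp [roots] at hs
  | cons t a ih =>
    rcases eq_or_ne t s with rfl | hts
    · exact ⟨a, List.Perm.refl _, cs.wordProd_cons _ _, List.sublist_cons_self _ _⟩
    have hst : (simpleRoot s : B → ℝ) ≠ simpleRoot t := by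
      intro h
      have := congrFun h s
      simp [simpleRoot, hts.symm] at this
    rw [roots, List.mem_cons, or_iff_right hst] at hs
    rw [roots, List.pairwise_cons] at h
    have hg : gram M s t = 0 := by
      have h1 := h.1 _ hs rfl
      rw [form_simpleRoot] at h1
      have h2 : (simpleRoot t : B → ℝ) s = 0 := by simp [simpleRoot, hts.symm]
      rw [h2] at h1
      linarith [gram_nonpos (M := M) hts.symm]
    have hrefl : simpleRefl M t (simpleRoot s) = simpleRoot s := by
      rw [simpleRefl_simpleRoot, gram_symm, hg]
      simp
    have hrefl2 : simpleRefl M s (simpleRoot t) = simpleRoot t := by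
      rw [simpleRefl_simpleRoot, hg]
      simp
    have hcomm := simple_mul_comm cs (gram_eq_zero_iff.1 hg)
    have hs1 : simpleRoot s ∈ roots M a := by
      obtain ⟨z, hz, hz2⟩ := List.mem_map.1 hs
      have : z = simpleRoot s := by
        rw [← simpleRefl_simpleRefl (M := M) t z, hz2, hrefl]
      rwa [← this]
    obtain ⟨b, h1, h2, h3⟩ := ih hs1 (by
      refine (List.pairwise_map.1 h.2).imp fun {x y} hxy hy => ?_
      have := hxy (by rw [hy, hrefl])
      rw [simpleRefl_apply_of_ne hts.symm] at this
      nth_rewrite 1 [← hrefl] at this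
      rwa [form_simpleRefl] at this)
    refine ⟨t :: b, (h1.cons t).trans (List.Perm.swap _ _ _), ?_, ?_⟩
    · rw [cs.wordProd_cons, h2, cs.wordProd_cons, ← mul_assoc, ← mul_assoc, hcomm]
    · rw [roots, roots, List.map_cons, hrefl2]
      refine List.Sublist.cons_cons _ ?_
      have := h3.map (simpleRefl M t)
      rw [List.map_map] at this ⊢
      convert this using 2
      funext x
      simp only [Function.comp_apply, ← geom_simple cs, ← geom_mul_apply, hcomm]

lemma le_apply_geom_simpleRoot {s : B} {p : List B} (hs : s ∉ p) (h : (B → ℝ) →ₗ[ℝ] ℝ)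
    (hp : ∀ x ∈ roots M p, 0 ≤ h x) :
    h (simpleRoot s) ≤ h (geom cs (cs.wordProd p) (simpleRoot s)) := by
  induction p using List.reverseRecOn with
  | nil => simp
  | append_singleton p t ih =>
    simp only [List.mem_append, List.mem_singleton, not_or] at hs
    rw [roots_concat (cs := cs)] at hp
    have h1 := ih hs.1 fun x hx => hp x (List.mem_append_left _ hx)
    have h2 := hp _ (List.mem_append_right _ (List.mem_singleton_self _))
    rw [cs.wordProd_append, cs.wordProd_singleton, geom_mul_apply, geom_simple,
      simpleRefl_simpleRoot, map_sub, map_smul, map_sub, map_smul, smul_eq_mul]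
    nlinarith [gram_nonpos (M := M) (Ne.symm hs.2)]

variable (M) in
/-- The form `skewForm M c` as a linear functional in its left argument. -/
def skewFormLeft (c : List B) (y : B → ℝ) : (B → ℝ) →ₗ[ℝ] ℝ where
  toFun x := skewForm M c x y
  map_add' x z := skewForm_add_left c x z y
  map_smul' k x := skewForm_smul_left c k x y

lemma notMem_of_simpleRoot_notMem_roots {s : B} {c a : List B} (hc : (s :: c).Nodup)
    (hall : ∀ b, b ∈ s :: c) (ha : cs.IsReduced a)
    (h : (roots M a).Pairwise fun x y => 0 ≤ skewForm M (s :: c) x y)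
    (hs : simpleRoot s ∉ roots M a) : s ∉ a := by
  intro hsa
  obtain ⟨p, q, rfl, hsp⟩ := List.eq_append_cons_of_mem hsa
  set β := geom cs (cs.wordProd p) (simpleRoot s) with hβ
  have hroots : roots M (p ++ s :: q) = roots M p ++
      β :: ((roots M q).map (simpleRefl M s)).map (geom cs (cs.wordProd p)) := by
    rw [roots_append (cs := cs), roots, List.map_cons]
  have hmem : β ∈ roots M (p ++ s :: q) := by
    rw [hroots]
    simp
  have hβ1 : IsRoot cs β := ⟨_, _, hβ⟩
  have hβ0 := nonneg_of_mem_roots ha hmem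
  rw [hroots, List.pairwise_append] at h
  have h1 : skewForm M (s :: c) (simpleRoot s) β ≤ skewForm M (s :: c) β β :=
    le_apply_geom_simpleRoot (cs := cs) hsp (skewFormLeft M (s :: c) β)
      fun x hx => h.2.2 x hx β List.mem_cons_self
  rw [skewForm_self] at h1
  have h2 := le_antisymm h1 (skewForm_simpleRoot_nonneg hc hβ0)
  have h3 : β s = 1 := by
    rw [hβ, geom_wordProd_apply_of_notMem hsp]
    simp [simpleRoot]
  rw [skewForm_simpleRoot_left (List.nodup_cons.1 hc).1, offDiag_eq hc hall, h3] at h2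
  have h4 : form M (simpleRoot s) β = 1 := by linarith
  have h5 := hβ1.simpleRefl_nonneg hβ0 (fun hh => hs (hh ▸ hmem)) s
  rw [simpleRefl_apply, h4] at h5
  norm_num [simpleRoot, h3] at h5

theorem exists_nestedWord_of_pairwise_roots {c a : List B} (hc : c.Nodup) (hall : ∀ b, b ∈ c)
    (ha : cs.IsReduced a) (h : (roots M a).Pairwise fun x y => 0 ≤ skewForm M c x y) :
    ∃ b, b.Perm a ∧ cs.wordProd b = cs.wordProd a ∧ NestedWord c b := by
  refine rotation_induction (P := fun c a => cs.IsReduced a →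
    ((roots M a).Pairwise fun x y => 0 ≤ skewForm M c x y) →
      ∃ b, b.Perm a ∧ cs.wordProd b = cs.wordProd a ∧ NestedWord c b) ?_ ?_ c a hc hall ha h
  · intro c _ _
    exact ⟨[], List.Perm.refl _, rfl, .nil c⟩
  · intro s c a hc hall ih1 ih2 ha h
    by_cases hs : simpleRoot s ∈ roots M a
    · obtain ⟨b, h1, h2, h3⟩ := exists_perm_cons (cs := cs) hs (h.imp fun {x y} hxy hy => by
        rw [hy, skewForm_skew, skewForm_simpleRoot_left (List.nodup_cons.1 hc).1,
          offDiag_eq hc hall] at hxy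
        linarith)
      have hlen : a.length = b.length + 1 := h1.length_eq
      have hb : cs.IsReduced b := by
        have h4 := cs.length_mul_le (cs.simple s) (cs.wordProd b)
        rw [← h2, ha, cs.length_simple] at h4
        exact le_antisymm (cs.length_wordProd_le b) (by omega)
      have h5 := List.pairwise_map.1 (h.sublist h3)
      simp only [skewForm_simpleRefl_symm hc hall] at h5
      obtain ⟨b', h6, h7, h8⟩ := ih1 b (by omega) hb h5
      exact ⟨s :: b', (h6.cons s).trans h1.symm, by rw [cs.wordProd_cons, h7, h2],
        h8.cons_of_concat⟩
    · have hsa := notMem_of_simpleRoot_notMem_roots hc hall ha h hs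
      obtain ⟨b, h6, h7, h8⟩ := ih2 (head?_ne_of_notMem hsa) ha (by
        refine h.imp_of_mem fun hx hy hxy => ?_
        rw [skewForm_cons_eq_concat hc hall, roots_apply_of_notMem hsa hx,
          roots_apply_of_notMem hsa hy] at hxy
        simpa using hxy)
      refine ⟨b, h6, h7, (h8.of_notMem fun hb => hsa (h6.subset hb)).mono ?_⟩
      simp

lemma skewForm_nonneg_of_eq_add {c a : List B} (ha : cs.IsReduced a)
    (h : (roots M a).Pairwise fun x y => 0 ≤ skewForm M c x y) {p q y : B → ℝ}
    (hp : p ∈ roots M a) (hq : q ∈ roots M a) (hy : IsRoot cs y) (hy0 : 0 ≤ y)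
    (hya : y ∉ roots M a) {k l : ℝ} (hk : 0 ≤ k) (hl : 0 ≤ l) (hqp : q = k • p + l • y) :
    0 ≤ skewForm M c p q := by
  rcases eq_or_ne p q with rfl | hpq
  · rw [skewForm_self]
  · exact rel_of_mem_roots_of_eq_add ha h hp hq hpq hy hy0 hya hk hl hqp

variable (cs) in
/-- Compatibility of `skewForm M c` with convex combinations of a positive root outside the roots
of a word with a root of this word. -/
def OuterConvex (c a : List B) : Prop :=
  ∀ (p q x : B → ℝ) (k l : ℝ), IsRoot cs p → 0 ≤ p → p ∉ roots M a → IsRoot cs q → 0 ≤ q →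
    q ∉ roots M a → x ∈ roots M a → 0 ≤ k → 0 ≤ l → q = k • p + l • x → 0 ≤ skewForm M c q p

lemma OuterConvex.skewForm_nonneg_of_form_ne_zero {c a : List B} (hO : OuterConvex cs c a)
    (ha : cs.IsReduced a) (h : (roots M a).Pairwise fun x y => 0 ≤ skewForm M c x y)
    {x y : B → ℝ} (hx : x ∈ roots M a) (hy : IsRoot cs y) (hy0 : 0 ≤ y) (hya : y ∉ roots M a)
    (hxy : form M x y ≠ 0) : 0 ≤ skewForm M c x y := by
  obtain ⟨hx1, hx0, hxn⟩ := (mem_roots_iff ha).1 hx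
  have hyn := geom_inv_nonneg_of_notMem_roots ha hy hy0 hya
  have hδ := hx1.sub_smul hy
  set k := form M x y
  rcases lt_or_gt_of_ne hxy with hk | hk
  · have hδ0 : 0 ≤ y - (2 * k) • x := by
      have : y - (2 * k) • x = y + (-(2 * k)) • x := by module
      rw [this]
      exact add_nonneg hy0 (smul_nonneg (by linarith) hx0)
    by_cases hm : y - (2 * k) • x ∈ roots M a
    · have h1 := skewForm_nonneg_of_eq_add ha h hx hm hy hy0 hya (k := -(2 * k)) (l := 1)
        (by linarith) zero_le_one (by module)
      have e : y - (2 * k) • x = y + (-(2 * k)) • x := by module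
      rwa [e, skewForm_add_right, skewForm_smul_right, skewForm_self, mul_zero, add_zero] at h1
    · have h1 := hO y (y - (2 * k) • x) x 1 (-(2 * k)) hy hy0 hya hδ hδ0 hm hx zero_le_one
        (by linarith) (by module)
      have e : y - (2 * k) • x = y + (-(2 * k)) • x := by module
      rw [e, skewForm_add_left, skewForm_smul_left, skewForm_self, zero_add] at h1
      exact nonneg_of_mul_nonneg_right h1 (by linarith)
  · rcases hδ.nonneg_or_nonpos with hδ0 | hδ0
    · have hm : y - (2 * k) • x ∉ roots M a := by
        intro hm
        have h1 := ((mem_roots_iff ha).1 hm).2.2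
        refine (hy.geom_apply (cs.wordProd a)⁻¹).eq_zero_of_le_of_le hyn ?_
        have e : y = (y - (2 * k) • x) + (2 * k) • x := by module
        rw [e, map_add, map_smul]
        exact add_nonpos h1 (smul_nonpos_of_nonneg_of_nonpos (by linarith) hxn)
      have h1 := hO (y - (2 * k) • x) y x 1 (2 * k) hδ hδ0 hm hy hy0 hya hx zero_le_one
        (by linarith) (by module)
      have e : y - (2 * k) • x = y + (-(2 * k)) • x := by module
      rw [e, skewForm_add_right, skewForm_smul_right, skewForm_self, skewForm_skew] at h1
      nlinarith
    · have hm : -(y - (2 * k) • x) ∈ roots M a := by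
        refine (mem_roots_iff ha).2 ⟨hδ.neg, neg_nonneg.2 hδ0, ?_⟩
        have e : -(y - (2 * k) • x) = (2 * k) • x + -y := by module
        rw [e, map_add, map_smul, map_neg]
        exact add_nonpos (smul_nonpos_of_nonneg_of_nonpos (by linarith) hxn) (neg_nonpos.2 hyn)
      have hk0 : (0 : ℝ) ≤ (2 * k)⁻¹ := by positivity
      have h1 := skewForm_nonneg_of_eq_add ha h hm hx hy hy0 hya hk0 hk0 (by
        have : x = ((2 * k)⁻¹ * (2 * k)) • x := by
          rw [inv_mul_cancel₀ (by linarith), one_smul]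
        nth_rewrite 1 [this]
        module)
      have e : -(y - (2 * k) • x) = (2 * k) • x + (-1 : ℝ) • y := by module
      rw [e, skewForm_add_left, skewForm_smul_left, skewForm_smul_left, skewForm_self,
        skewForm_skew] at h1
      linarith

lemma simpleRefl_mem_roots_cons_iff {s : B} {b : List B} {z : B → ℝ} (hz : IsRoot cs z)
    (hz0 : 0 ≤ z) : simpleRefl M s z ∈ roots M (s :: b) ↔ z ∈ roots M b := by
  rw [roots, List.mem_cons, List.mem_map]
  constructor
  · rintro (h | ⟨y, hy, h⟩)
    · exfalso
      refine hz.eq_zero_of_le_of_le hz0 ?_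
      rw [← simpleRefl_simpleRefl (M := M) s z, h, simpleRefl_self]
      exact neg_nonpos.2 (simpleRoot_nonneg s)
    · rw [← simpleRefl_simpleRefl (M := M) s z, ← h, simpleRefl_simpleRefl]
      exact hy
  · exact fun h => Or.inr ⟨z, h, rfl⟩

lemma OuterConvex.of_cons {s : B} {c b : List B} (hO : OuterConvex cs (s :: c) (s :: b))
    (hc : (s :: c).Nodup) (hall : ∀ b, b ∈ s :: c) (hb : cs.IsReduced (s :: b)) :
    OuterConvex cs (c ++ [s]) b := by
  intro p q x k l hp hp0 hpb hq hq0 hqb hx hk hl hqp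
  obtain ⟨hb1, hb2⟩ := isReduced_cons_iff.1 hb
  rw [← simpleRoot_mem_roots_iff hb1] at hb2
  obtain ⟨hx1, hx0, -⟩ := (mem_roots_iff hb1).1 hx
  have hsc := (List.nodup_cons.1 hc).1
  rcases eq_or_ne p (simpleRoot s) with rfl | hps
  · have e : (simpleRoot s : B → ℝ) = (-1 : ℝ) • -simpleRoot s := by module
    rw [← skewForm_simpleRefl_symm hc hall, simpleRefl_self, ← neg_one_smul ℝ, skewForm_smul_right,
      skewForm_skew, skewForm_simpleRoot_left hsc]
    rw [offDiag_congr (x := simpleRefl M s q) (y := q)]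
    · linarith [offDiag_nonneg (M := M) hsc hq0]
    · intro j hj
      apply simpleRefl_apply_of_ne
      rintro rfl
      exact hsc hj
  rcases eq_or_ne q (simpleRoot s) with rfl | hqs
  · rcases hl.eq_or_lt with rfl | hl
    · rw [hqp, zero_smul, add_zero, skewForm_smul_left, skewForm_self, mul_zero]
    · exfalso
      have : x = simpleRoot s := by
        refine hx1.eq_simpleRoot hx0 fun j hj => ?_
        have h1 := congrFun hqp j
        simp only [simpleRoot, Pi.add_apply, Pi.smul_apply, smul_eq_mul, ne_eq, hj,
          not_false_eq_true, Pi.single_eq_of_ne] at h1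
        have h2 : 0 ≤ k * p j := mul_nonneg hk (hp0 j)
        have h3 : 0 ≤ l * x j := mul_nonneg hl.le (hx0 j)
        exact (mul_eq_zero.1 (show l * x j = 0 by linarith)).resolve_left hl.ne'
      exact hb2 (this ▸ hx)
  · rw [← skewForm_simpleRefl_symm hc hall]
    refine hO _ _ (simpleRefl M s x) k l (hp.simpleRefl_apply s) (hp.simpleRefl_nonneg hp0 hps)
      (fun h => hpb ((simpleRefl_mem_roots_cons_iff hp hp0).1 h)) (hq.simpleRefl_apply s)
      (hq.simpleRefl_nonneg hq0 hqs)
      (fun h => hqb ((simpleRefl_mem_roots_cons_iff hq hq0).1 h))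
      ((simpleRefl_mem_roots_cons_iff hx1 hx0).2 hx) hk hl ?_
    rw [hqp, map_add, map_smul, map_smul]

theorem NestedWord.skewForm_nonneg {c a : List B} (h : NestedWord c a) (hc : c.Nodup)
    (hall : ∀ b, b ∈ c) (ha : cs.IsReduced a) (hO : OuterConvex cs c a) :
    ∀ x ∈ roots M a, ∀ y, IsRoot cs y → 0 ≤ y → y ∉ roots M a → 0 ≤ skewForm M c x y := by
  refine rotation_induction (P := fun c a => NestedWord c a → cs.IsReduced a →
    OuterConvex cs c a → ∀ x ∈ roots M a, ∀ y, IsRoot cs y → 0 ≤ y → y ∉ roots M a →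
      0 ≤ skewForm M c x y) ?_ ?_ c a hc hall h ha hO
  · intro c _ _ _ x hx
    simp [roots] at hx
  · intro s c a hc hall ih1 ih2 h ha hO x hx y hy hy0 hya
    have hsc := (List.nodup_cons.1 hc).1
    rcases h.cons_cases hsc with ⟨b, rfl, h1⟩ | ⟨hs, h1⟩
    · have h2 := ih1 b (by simp) h1 (isReduced_of_cons ha) (hO.of_cons hc hall ha)
      have hys : y ≠ simpleRoot s := by
        rintro rfl
        exact hya List.mem_cons_self
      rcases List.mem_cons.1 hx with rfl | hx
      · exact skewForm_simpleRoot_nonneg hc hy0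
      · obtain ⟨z, hz, rfl⟩ := List.mem_map.1 hx
        rw [← simpleRefl_simpleRefl (M := M) s y, skewForm_simpleRefl_symm hc hall]
        have hy' := hy.simpleRefl_nonneg hy0 hys
        refine h2 z hz _ (hy.simpleRefl_apply s) hy' fun hm => hya ?_
        rw [← simpleRefl_simpleRefl (M := M) s y]
        exact (simpleRefl_mem_roots_cons_iff (hy.simpleRefl_apply s) hy').2 hm
    · have hpw := h.pairwise_roots hc hall ha
      have hform : ∀ z ∈ roots M a, form M (simpleRoot s) z = 0 := by
        intro z hz
        by_contra hne
        have h2 := hO.skewForm_nonneg_of_form_ne_zero ha hpw hz (isRoot_simpleRoot s)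
          (simpleRoot_nonneg s) (simpleRoot_notMem_roots hs) (by rwa [form_comm])
        have h3 := offDiag_nonneg (M := M) hsc (nonneg_of_mem_roots ha hz)
        rw [skewForm_skew, skewForm_simpleRoot_left hsc] at h2
        rw [offDiag_eq hc hall, roots_apply_of_notMem hs hz] at h2 h3
        exact hne (by linarith)
      have hO2 : OuterConvex cs (c ++ [s]) a := by
        intro p q z k l hp hp0 hpa hq hq0 hqa hz hk hl hqp
        have h2 := hO p q z k l hp hp0 hpa hq hq0 hqa hz hk hl hqp
        rw [skewForm_cons_eq_concat hc hall] at h2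
        have e1 : q s = k * p s := by
          rw [hqp]
          simp [roots_apply_of_notMem hs hz]
        have e2 : form M (simpleRoot s) q = k * form M (simpleRoot s) p := by
          rw [hqp]
          simp [hform z hz]
        rw [e1, e2] at h2
        linarith
      have h2 := ih2 (head?_ne_of_notMem hs) (h1.mono (List.sublist_append_left _ _)) ha hO2 x hx y
        hy hy0 hya
      rw [skewForm_cons_eq_concat hc hall, hform x hx, roots_apply_of_notMem hs hx]
      linarith

end Criterion

section Commutation

lemma CommMove.perm {a b : List B} (h : CommMove M a b) : a.Perm b := by
  obtain ⟨l₁, l₂, x, y, -, rfl, rfl⟩ := h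
  exact (List.Perm.swap _ _ _).append_left l₁

lemma CommMove.wordProd_eq (cs : CoxeterSystem M W) {a b : List B} (h : CommMove M a b) :
    cs.wordProd a = cs.wordProd b := by
  obtain ⟨l₁, l₂, x, y, hxy, rfl, rfl⟩ := h
  rw [cs.wordProd_append, cs.wordProd_append, cs.wordProd_cons, cs.wordProd_cons,
    cs.wordProd_cons, cs.wordProd_cons, ← mul_assoc (cs.simple x), simple_mul_comm cs hxy,
    mul_assoc (cs.simple y)]

lemma CommEquiv.perm {a b : List B} (h : CommEquiv M a b) : a.Perm b := by
  induction h with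
  | refl => exact List.Perm.refl a
  | tail _ h ih => exact ih.trans h.perm

lemma CommEquiv.wordProd_eq (cs : CoxeterSystem M W) {a b : List B} (h : CommEquiv M a b) :
    cs.wordProd a = cs.wordProd b := by
  induction h with
  | refl => rfl
  | tail _ h ih => exact ih.trans (h.wordProd_eq cs)

lemma CommMove.exists_erase {a p q : List B} {t : B} (h : CommMove M a (p ++ t :: q))
    (ht : t ∉ q) :
    ∃ p' q', a = p' ++ t :: q' ∧ t ∉ q' ∧ CommEquiv M (p' ++ q') (p ++ q) := by
  obtain ⟨l₁, l₂, x, y, hxy, rfl, h⟩ := h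
  have hne : x ≠ y := by
    rintro rfl
    simp at hxy
  rcases List.append_eq_append_iff.1 h with ⟨e, rfl, he⟩ | ⟨e, rfl, he⟩
  · rcases e with _ | ⟨z, e⟩
    · obtain ⟨rfl, rfl⟩ : t = y ∧ q = x :: l₂ := by simpa using he
      refine ⟨p ++ [x], l₂, by simp, fun hh => ht (List.mem_cons_of_mem _ hh), ?_⟩
      rw [List.append_assoc]
      exact .refl
    · obtain ⟨rfl, rfl⟩ : t = z ∧ q = e ++ y :: x :: l₂ := by simpa using he
      refine ⟨p, e ++ x :: y :: l₂, by simp, ?_, .single ⟨p ++ e, l₂, x, y, hxy, ?_, ?_⟩⟩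
      · simp only [List.mem_append, List.mem_cons] at ht ⊢
        tauto
      · simp
      · simp
  · rcases e with _ | ⟨z, _ | ⟨z', e⟩⟩
    · obtain ⟨rfl, rfl⟩ : y = t ∧ x :: l₂ = q := by simpa using he
      refine ⟨l₁ ++ [x], l₂, by simp, fun hh => ht (List.mem_cons_of_mem _ hh), ?_⟩
      simp only [List.append_assoc, List.append_nil]
      exact .refl
    · obtain ⟨rfl, rfl, rfl⟩ : y = z ∧ x = t ∧ l₂ = q := by simpa using he
      refine ⟨l₁, y :: l₂, rfl, ?_, ?_⟩
      · simp [hne, ht]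
      · rw [List.append_assoc]
        exact .refl
    · obtain ⟨rfl, rfl, rfl⟩ : y = z ∧ x = z' ∧ l₂ = e ++ t :: q := by simpa using he
      refine ⟨l₁ ++ x :: y :: e, q, by simp, ht, .single ⟨l₁, e ++ q, x, y, hxy, ?_, ?_⟩⟩
      · simp
      · simp

lemma CommEquiv.exists_erase {a v : List B} {t : B} (h : CommEquiv M a (v ++ [t])) :
    ∃ p q, a = p ++ t :: q ∧ t ∉ q ∧ CommEquiv M (p ++ q) v := by
  induction h using Relation.ReflTransGen.head_induction_on with
  | refl => exact ⟨v, [], rfl, by simp, by rw [List.append_nil]; exact .refl⟩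
  | head h _ ih =>
    obtain ⟨p, q, rfl, ht, h1⟩ := ih
    obtain ⟨p', q', h2, h3, h4⟩ := h.exists_erase ht
    exact ⟨p', q', h2, h3, h4.trans h1⟩

end Commutation

section Longest

variable {cs : CoxeterSystem M W} {w₀ : W}

lemma isRightDescent_longest (hw₀ : ∀ u : W, cs.length u ≤ cs.length w₀) (i : B) :
    cs.IsRightDescent w₀ i := by
  by_contra h
  have h1 := cs.not_isRightDescent_iff.1 h
  have h2 := hw₀ (w₀ * cs.simple i)
  omega

lemma isRightDescent_longest_inv (hw₀ : ∀ u : W, cs.length u ≤ cs.length w₀) (i : B) :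
    cs.IsRightDescent w₀⁻¹ i :=
  isRightDescent_longest (fun u => by rw [cs.length_inv]; exact hw₀ u) i

variable [Fintype B] [DecidableEq B]

lemma geom_injective {g h : W} (H : geom cs g = geom cs h) : g = h := by
  rw [← mul_inv_eq_one]
  apply geom_eq_one (cs := cs)
  rw [map_mul, H, ← map_mul, mul_inv_cancel, map_one]

lemma sum_smul_simpleRoot (x : B → ℝ) : ∑ i, x i • (simpleRoot i : B → ℝ) = x := by
  conv_rhs => rw [← Finset.univ_sum_single x]
  refine Finset.sum_congr rfl fun i _ => ?_
  rw [simpleRoot, ← Pi.single_smul, smul_eq_mul, mul_one]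

lemma geom_nonpos {g : W} (hg : ∀ i, cs.IsRightDescent g i) {x : B → ℝ} (hx : 0 ≤ x) :
    geom cs g x ≤ 0 := by
  rw [← sum_smul_simpleRoot x, map_sum]
  refine Finset.sum_nonpos fun i _ => ?_
  rw [map_smul]
  exact smul_nonpos_of_nonneg_of_nonpos (hx i) (geom_simpleRoot_nonpos (hg i))

lemma exists_conj_longest (hw₀ : ∀ u : W, cs.length u ≤ cs.length w₀) (t : B) :
    ∃ i, geom cs w₀ (simpleRoot i) = -simpleRoot t ∧ w₀ * cs.simple i = cs.simple t * w₀ := by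
  set x := -geom cs w₀⁻¹ (simpleRoot t) with hx
  have hx0 : 0 ≤ x := neg_nonneg.2 (geom_nonpos (isRightDescent_longest_inv hw₀)
    (simpleRoot_nonneg t))
  have hwx : geom cs w₀ x = -simpleRoot t := by
    rw [hx, map_neg, geom_apply_inv_self]
  obtain ⟨i, hi⟩ : ∃ i, x i ≠ 0 := by
    by_contra! h
    have : x = 0 := funext h
    rw [this, map_zero] at hwx
    have := congrFun hwx t
    simp [simpleRoot] at this
  have hpos (j : B) : 0 ≤ -geom cs w₀ (simpleRoot j) :=
    neg_nonneg.2 (geom_simpleRoot_nonpos (isRightDescent_longest hw₀ j))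
  have hroot : -geom cs w₀ (simpleRoot i) = simpleRoot t := by
    refine ((isRoot_simpleRoot i).geom_apply w₀).neg.eq_simpleRoot (hpos i) fun j hj => ?_
    have h1 : ∑ k, x k * (-geom cs w₀ (simpleRoot k)) j = 0 := by
      have h2 := congrFun hwx j
      rw [← sum_smul_simpleRoot x, map_sum, Finset.sum_apply] at h2
      simp only [map_smul, Pi.smul_apply, smul_eq_mul, Pi.neg_apply, simpleRoot, ne_eq, hj,
        not_false_eq_true, Pi.single_eq_of_ne, neg_zero] at h2
      simp only [Pi.neg_apply, mul_neg, Finset.sum_neg_distrib, neg_eq_zero]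
      exact h2
    rw [Finset.sum_eq_zero_iff_of_nonneg fun k _ => mul_nonneg (hx0 k) (hpos k j)] at h1
    exact (mul_eq_zero.1 (h1 i (Finset.mem_univ i))).resolve_left hi
  have hroot2 := neg_eq_iff_eq_neg.1 hroot
  refine ⟨i, hroot2, geom_injective (cs := cs) (LinearMap.ext fun y => ?_)⟩
  rw [geom_mul_apply, geom_mul_apply, geom_simple, geom_simple, simpleRefl_apply,
    simpleRefl_apply, ← form_geom cs w₀ (simpleRoot i), map_sub, map_smul, hroot2]
  simp

lemma mem_roots_iff_notMem_roots (hw₀ : ∀ u : W, cs.length u ≤ cs.length w₀) {a b : List B}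
    (ha : cs.IsReduced a) (hb : cs.IsReduced b) (hab : cs.wordProd b = cs.wordProd a * w₀)
    {β : B → ℝ} (hβ : IsRoot cs β) (hβ0 : 0 ≤ β) : β ∈ roots M b ↔ β ∉ roots M a := by
  have h0 {x : B → ℝ} (hx : 0 ≤ x) : geom cs w₀⁻¹ x ≤ 0 :=
    geom_nonpos (isRightDescent_longest_inv hw₀) hx
  rw [mem_roots_iff hb, hab, mul_inv_rev, geom_mul_apply]
  constructor
  · rintro ⟨-, -, h1⟩ h2
    refine ((hβ.geom_apply (cs.wordProd a)⁻¹).geom_apply w₀⁻¹).eq_zero_of_le_of_le ?_ h1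
    have h3 := h0 (neg_nonneg.2 ((mem_roots_iff ha).1 h2).2.2)
    rw [map_neg] at h3
    exact neg_nonpos.1 h3
  · exact fun h => ⟨hβ, hβ0, h0 (geom_inv_nonneg_of_notMem_roots ha hβ hβ0 h)⟩

lemma outerConvex_of_isReduced (hw₀ : ∀ u : W, cs.length u ≤ cs.length w₀) {c a b : List B}
    (ha : cs.IsReduced a) (hb : cs.IsReduced b) (hab : cs.wordProd b = cs.wordProd a * w₀)
    (h : (roots M b).Pairwise fun x y => 0 ≤ skewForm M c.reverse x y) :
    OuterConvex cs c a := by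
  intro p q x k l hp hp0 hpa hq hq0 hqa hx hk hl hqp
  obtain ⟨hx1, hx0, -⟩ := (mem_roots_iff ha).1 hx
  have h1 := skewForm_nonneg_of_eq_add hb h
    ((mem_roots_iff_notMem_roots hw₀ ha hb hab hp hp0).2 hpa)
    ((mem_roots_iff_notMem_roots hw₀ ha hb hab hq hq0).2 hqa) hx1 hx0
    (fun hxb => (mem_roots_iff_notMem_roots hw₀ ha hb hab hx1 hx0).1 hxb hx) hk hl hqp
  rwa [skewForm_reverse, ← skewForm_skew] at h1

theorem isSortable_reverse_mul_simple (hw₀ : ∀ u : W, cs.length u ≤ cs.length w₀)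
    {c a : List B} (hc : c.Nodup) (hall : ∀ b, b ∈ c) (ha : cs.IsReduced a)
    (hca : NestedWord c a) (h : IsSortable cs c.reverse (cs.wordProd a * w₀)) {t : B}
    (ht : cs.IsRightDescent (cs.wordProd a) t) :
    IsSortable cs c.reverse (cs.wordProd a * cs.simple t * w₀) := by
  have hc' : c.reverse.Nodup := List.nodup_reverse.2 hc
  have hall' : ∀ b, b ∈ c.reverse := fun b => List.mem_reverse.2 (hall b)
  obtain ⟨b, hb, hab, hcb⟩ : ∃ b, cs.IsReduced b ∧ cs.wordProd b = cs.wordProd a * w₀ ∧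
      NestedWord c.reverse b :=
    ⟨_, isReduced_sortingWord cs hall' _, wordProd_sortingWord cs hall' _, h.nestedWord hc'⟩
  obtain ⟨i, hi, hit⟩ := exists_conj_longest hw₀ t
  have hbi : cs.wordProd (b ++ [i]) = cs.wordProd a * cs.simple t * w₀ := by
    rw [cs.wordProd_append, cs.wordProd_singleton, hab, mul_assoc, hit, mul_assoc]
  have hβ : geom cs (cs.wordProd b) (simpleRoot i) =
      -geom cs (cs.wordProd a) (simpleRoot t) := by
    rw [hab, geom_mul_apply, hi, map_neg]
  have hβ0 : 0 ≤ -geom cs (cs.wordProd a) (simpleRoot t) :=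
    neg_nonneg.2 (geom_simpleRoot_nonpos ht)
  have hβ1 : IsRoot cs (-geom cs (cs.wordProd a) (simpleRoot t)) :=
    ((isRoot_simpleRoot t).geom_apply _).neg
  have hred : cs.IsReduced (b ++ [i]) := by
    refine isReduced_concat_iff.2 ⟨hb, fun hd => hβ1.eq_zero_of_le_of_le hβ0 ?_⟩
    rw [← hβ]
    exact geom_simpleRoot_nonpos hd
  have hβa : -geom cs (cs.wordProd a) (simpleRoot t) ∈ roots M a := by
    refine (mem_roots_iff ha).2 ⟨hβ1, hβ0, ?_⟩
    rw [map_neg, geom_inv_apply_self]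
    exact neg_nonpos.2 (simpleRoot_nonneg t)
  have hpw := hcb.pairwise_roots hc' hall' hb
  have hcross := hca.skewForm_nonneg hc hall ha (outerConvex_of_isReduced hw₀ ha hb hab hpw) _ hβa
  have hpw' : (roots M (b ++ [i])).Pairwise fun x y => 0 ≤ skewForm M c.reverse x y := by
    rw [roots_concat (cs := cs), List.pairwise_append]
    refine ⟨hpw, List.pairwise_singleton _ _, fun y hy z hz => ?_⟩
    rw [List.mem_singleton.1 hz, hβ, skewForm_reverse, ← skewForm_skew]
    obtain ⟨hy1, hy0, -⟩ := (mem_roots_iff hb).1 hy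
    exact hcross y hy1 hy0 ((mem_roots_iff_notMem_roots hw₀ ha hb hab hy1 hy0).1 hy)
  obtain ⟨b', hp, he, hn⟩ := exists_nestedWord_of_pairwise_roots hc' hall' hred hpw'
  rw [← hbi, ← he]
  refine hn.isSortable cs hc' ?_
  rw [CoxeterSystem.IsReduced, he, hred.eq, hp.length_eq]

theorem isCSingleton_of_commEquiv_append (hw₀ : ∀ u : W, cs.length u ≤ cs.length w₀)
    {c a u r : List B} (hc : c.Nodup) (hall : ∀ b, b ∈ c) (ha : cs.IsReduced a)
    (hca : NestedWord c a) (h : IsSortable cs c.reverse (cs.wordProd a * w₀))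
    (har : CommEquiv M a (u ++ r)) :
    IsCSingleton cs c w₀ (cs.wordProd u) := by
  induction r using List.reverseRecOn generalizing a with
  | nil =>
    rw [List.append_nil] at har
    rw [← har.wordProd_eq cs]
    exact ⟨hca.isSortable cs hc ha, h⟩
  | append_singleton r t ih =>
    rw [← List.append_assoc] at har
    have h1 := har.wordProd_eq cs
    have h2 := har.perm.length_eq
    obtain ⟨p, q, rfl, htq, hpq⟩ := har.exists_erase
    have h3 := hpq.wordProd_eq cs
    have h4 := hpq.perm.length_eq
    have hred : cs.IsReduced (u ++ r ++ [t]) := by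
      rw [CoxeterSystem.IsReduced, ← h1, ← h2, ha]
    have hred2 := (isReduced_concat_iff.1 hred).1
    have h5 : cs.wordProd (p ++ q) = cs.wordProd (p ++ t :: q) * cs.simple t := by
      rw [h1, cs.wordProd_append _ [t], cs.wordProd_singleton,
        cs.simple_mul_simple_cancel_right, h3]
    have hred3 : cs.IsReduced (p ++ q) := by
      rw [CoxeterSystem.IsReduced, h3, h4, hred2]
    refine ih hred3 (hca.erase htq) ?_ hpq
    rw [h5]
    refine isSortable_reverse_mul_simple hw₀ hc hall ha hca h ?_
    rw [CoxeterSystem.IsRightDescent, ← h5, hred3, ha]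
    simp

end Longest

/-- Proposition.  Let `w` be a `c`-singleton and `𝐰` its `c`-sorting word.
Every element of `W` which is a prefix of `𝐰` up to commutations is again a `c`-singleton. -/
theorem statement6 [Finite W] (cs : CoxeterSystem M W)
    (c : List B) (hnd : c.Nodup) (hall : ∀ b : B, b ∈ c)
    (w₀ : W) (hw₀ : ∀ u : W, cs.length u ≤ cs.length w₀)
    (w : W) (hw : IsCSingleton cs c w₀ w)
    (u : W) (hu : IsPrefixUpToComm cs (sortingWord cs c w) u) :
    IsCSingleton cs c w₀ u := by
  classical
  have : Fintype B := ⟨c.toFinset, fun b => List.mem_toFinset.2 (hall b)⟩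
  obtain ⟨v', u', hv, ⟨r, rfl⟩, rfl⟩ := hu
  refine isCSingleton_of_commEquiv_append hw₀ hnd hall (isReduced_sortingWord cs hall w)
    (hw.1.nestedWord hnd) ?_ hv
  rw [wordProd_sortingWord cs hall]
  exact hw.2

end CambrianPaper

end
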